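/- arXiv:1607.08338 — 12 statements merged into one kernel-verified Lean document; each statement's English description precedes it below -/
import Mathlib

section
/- Let x ∈ {0,1}^n, let I = {i : x_i = 1}, and let y* be the greedy improvement vector for x. If Σ_{i∈I} w̄_i·y*_i ≥ Σ_{i∈I} w_i − B, then (x, y*) is a feasible solution of (iK-cs). -/
/-- Telescoping of a function of the partial sums of a finite family. -/
theorem Fin.sum_comp_sum_Iic_sub_comp_sum_Iio {M N : Type*} [AddCommMonoid M] [AddCommGroup N]
    {n : ℕ} (F : M → N) (a : Fin n → M) :
    ∑ i, (F (∑ l ∈ Finset.Iic i, a l) - F (∑ l ∈ Finset.Iio i, a l)) = F (∑ i, a i) - F 0 := by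
  let S : ℕ → M := fun k => ∑ l : Fin n with l.val < k, a l
  have hIic (i : Fin n) : ∑ l ∈ Finset.Iic i, a l = S (i + 1) := by
    refine Finset.sum_congr ?_ fun _ _ => rfl
    ext l
    simp only [Finset.mem_Iic, Finset.mem_filter, Finset.mem_univ, true_and, Fin.le_def,
      Nat.lt_succ_iff]
  have hIio (i : Fin n) : ∑ l ∈ Finset.Iio i, a l = S i := by
    refine Finset.sum_congr ?_ fun _ _ => rfl
    ext l
    simp
  simp only [hIic, hIio]
  rw [Fin.sum_univ_eq_sum_range (fun k => F (S (k + 1)) - F (S k)) n,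
    Finset.sum_range_sub (fun k => F (S k)) n]
  simp [S]

/-- Let `x ∈ {0,1}ⁿ`, let `I = {i : x i = 1}`, and let `ystar` be the greedy
improvement vector for `x`.  If `∑_{i∈I} w̄ i * ystar i ≥ ∑_{i∈I} w i - B`, then `(x, ystar)`
is a feasible solution of (iK-cs).  (Since `ystar i = 0` and `x i = 0` for `i ∉ I`, the sums
over `I` coincide with the sums over all items.) -/
theorem stmt_0 (n : ℕ) (hn : 1 ≤ n)
    (p w wbar c : Fin n → ℝ) (B C : ℝ)
    (hwbar : ∀ i, 0 < wbar i) (hc : ∀ i, 0 < c i) (hC : 0 ≤ C)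
    (hsort : ∀ i j : Fin n, i ≤ j → c i / wbar i ≤ c j / wbar j)
    (x : Fin n → ℝ) (hx : ∀ i, x i = 0 ∨ x i = 1)
    (ystar : Fin n → ℝ)
    (hystar : ∀ i : Fin n, ystar i =
      if x i = 1 ∧ (∑ ℓ ∈ Finset.Iic i, c ℓ * x ℓ) < C then 1
      else if x i = 1 ∧ (∑ ℓ ∈ Finset.Iio i, c ℓ * x ℓ) < C ∧
          C ≤ ∑ ℓ ∈ Finset.Iic i, c ℓ * x ℓ then
        (C - ∑ ℓ ∈ Finset.Iio i, c ℓ * x ℓ) / c i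
      else 0)
    (hcover : (∑ i, w i * x i) - B ≤ ∑ i, wbar i * ystar i) :
    (∀ i, 0 ≤ ystar i ∧ ystar i ≤ x i) ∧
      (∑ i, w i * x i) - (∑ i, wbar i * ystar i) ≤ B ∧
      (∑ i, c i * ystar i) ≤ C := by
  have hstep (i : Fin n) : ∑ l ∈ Finset.Iic i, c l * x l
      = c i * x i + ∑ l ∈ Finset.Iio i, c l * x l := by
    rw [← Finset.Iio_insert, Finset.sum_insert (by simp)]
  have hspent (i : Fin n) : (0 ≤ ystar i ∧ ystar i ≤ x i) ∧
      c i * ystar i = min C (∑ l ∈ Finset.Iic i, c l * x l)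
        - min C (∑ l ∈ Finset.Iio i, c l * x l) := by
    have hci := hc i
    rw [hystar i]
    have h := hstep i
    generalize (∑ l ∈ Finset.Iic i, c l * x l) = s at h ⊢
    generalize (∑ l ∈ Finset.Iio i, c l * x l) = t at h ⊢
    rcases hx i with h0 | h1
    · have hst : s = t := by simpa [h0] using h
      simp [h0, hst]
    · rw [h1, mul_one] at h
      rw [h1]
      split_ifs with hs ht
      · rw [min_eq_right hs.2.le, min_eq_right (by linarith [hs.2])]
        exact ⟨by norm_num, by linarith⟩
      · rw [min_eq_left ht.2.2, min_eq_right ht.2.1.le]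
        refine ⟨⟨div_nonneg (by linarith [ht.2.1]) hci.le, ?_⟩, mul_div_cancel₀ _ hci.ne'⟩
        rw [div_le_one hci]
        linarith [ht.2.2]
      · have hCs : C ≤ s := by simpa using hs
        have hCt : C ≤ t := by simpa [hCs] using ht
        simp [hCs, hCt]
  refine ⟨fun i => (hspent i).1, by linarith, ?_⟩
  rw [Finset.sum_congr rfl fun i _ => (hspent i).2,
    Fin.sum_comp_sum_Iic_sub_comp_sum_Iio (min C) fun l => c l * x l, min_eq_right hC, sub_zero]
  exact min_le_left _ _
end

section
/- Let x ∈ {0,1}^n, let I = {i : x_i = 1}, and let y* be the greedy improvement vector for x. If Σ_{i∈I} w̄_i·y*_i < Σ_{i∈I} w_i − B, then there exists no y ∈ ℝ^n such that (x, y) is a feasible solution of (iK-cs). -/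
open Finset in
/-- Optimality of greedy filling for the continuous knapsack: if `z` takes the full upper bound `x`
before a critical item `k` and nothing after it, and uses up the whole budget, then no admissible
`y` within the same budget collects more. -/
theorem sum_mul_le_of_critical {ι : Type*} [Fintype ι] [LinearOrder ι] {v c x y z : ι → ℝ} {k : ι}
    (hv : ∀ i, 0 < v i) (hc : ∀ i, 0 < c i)
    (hsort : ∀ i j, i ≤ j → c i / v i ≤ c j / v j)
    (hy : ∀ i, 0 ≤ y i ∧ y i ≤ x i)
    (hlt : ∀ i, i < k → z i = x i) (hgt : ∀ i, k < i → z i = 0)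
    (hcost : ∑ i, c i * y i ≤ ∑ i, c i * z i) :
    ∑ i, v i * y i ≤ ∑ i, v i * z i := by
  have hterm : ∀ i, v i * y i - v i * z i ≤ v k / c k * (c i * y i - c i * z i) := by
    intro i
    have hk := hc k
    have hratio : ∀ i j, i ≤ j → c i * v j ≤ c j * v i := fun i j h =>
      (div_le_div_iff₀ (hv i) (hv j)).1 (hsort i j h)
    rw [div_mul_eq_mul_div, le_div_iff₀ hk]
    rcases lt_trichotomy i k with h | rfl | h
    · rw [hlt i h]
      nlinarith [mul_nonneg (sub_nonneg.2 (hratio i k h.le)) (sub_nonneg.2 (hy i).2)]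
    · exact le_of_eq (by ring)
    · rw [hgt i h]
      nlinarith [mul_nonneg (sub_nonneg.2 (hratio k i h.le)) (hy i).1]
  have hsum := Finset.sum_le_sum fun i (_ : i ∈ univ) => hterm i
  rw [← Finset.mul_sum, Finset.sum_sub_distrib, Finset.sum_sub_distrib] at hsum
  have := mul_nonneg (div_pos (hv k) (hc k)).le (sub_nonneg.2 hcost)
  linarith

/-- Let `x ∈ {0,1}ⁿ`, let `I = {i : x i = 1}`, and let `ystar` be the greedy
improvement vector for `x`.  If `∑_{i∈I} w̄ i * ystar i < ∑_{i∈I} w i - B`, then there exists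
no `y ∈ ℝⁿ` such that `(x, y)` is a feasible solution of (iK-cs).  (Since `ystar i = 0` and
`x i = 0` for `i ∉ I`, the sums over `I` coincide with the sums over all items.) -/
theorem stmt_1 (n : ℕ) (hn : 1 ≤ n)
    (p w wbar c : Fin n → ℝ) (B C : ℝ)
    (hwbar : ∀ i, 0 < wbar i) (hc : ∀ i, 0 < c i) (hC : 0 ≤ C)
    (hsort : ∀ i j : Fin n, i ≤ j → c i / wbar i ≤ c j / wbar j)
    (x : Fin n → ℝ) (hx : ∀ i, x i = 0 ∨ x i = 1)
    (ystar : Fin n → ℝ)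
    (hystar : ∀ i : Fin n, ystar i =
      if x i = 1 ∧ (∑ ℓ ∈ Finset.Iic i, c ℓ * x ℓ) < C then 1
      else if x i = 1 ∧ (∑ ℓ ∈ Finset.Iio i, c ℓ * x ℓ) < C ∧
          C ≤ ∑ ℓ ∈ Finset.Iic i, c ℓ * x ℓ then
        (C - ∑ ℓ ∈ Finset.Iio i, c ℓ * x ℓ) / c i
      else 0)
    (hshort : (∑ i, wbar i * ystar i) < (∑ i, w i * x i) - B) :
    ¬ ∃ y : Fin n → ℝ,
      (∀ i, 0 ≤ y i ∧ y i ≤ x i) ∧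
      (∑ i, w i * x i) - (∑ i, wbar i * y i) ≤ B ∧
      (∑ i, c i * y i) ≤ C := by
  rintro ⟨y, hy, hB, hyC⟩
  suffices h : ∑ i, wbar i * y i ≤ ∑ i, wbar i * ystar i by linarith
  have hx0 : ∀ i, 0 ≤ x i := fun i => (hy i).1.trans (hy i).2
  have hcx : ∀ i, 0 ≤ c i * x i := fun i => mul_nonneg (hc i).le (hx0 i)
  have hmono : ∀ {s t : Finset (Fin n)}, s ⊆ t → ∑ ℓ ∈ s, c ℓ * x ℓ ≤ ∑ ℓ ∈ t, c ℓ * x ℓ :=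
    fun hst => Finset.sum_le_sum_of_subset_of_nonneg hst fun i _ _ => hcx i
  have hfull : ∀ i, (∑ ℓ ∈ Finset.Iic i, c ℓ * x ℓ) < C → ystar i = x i := by
    intro i hi
    rw [hystar i]
    rcases hx i with h | h <;> simp [h, hi, hi.not_ge]
  have hempty : ∀ i, C ≤ (∑ ℓ ∈ Finset.Iio i, c ℓ * x ℓ) → ystar i = 0 := by
    intro i hi
    have hi' := hi.trans (hmono Finset.Iio_subset_Iic_self)
    rw [hystar i, if_neg fun h => hi'.not_gt h.2, if_neg fun h => hi.not_gt h.2.1]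
  by_cases htot : ∑ ℓ, c ℓ * x ℓ < C
  · refine Finset.sum_le_sum fun i _ => mul_le_mul_of_nonneg_left ?_ (hwbar i).le
    rw [hfull i ((hmono (Finset.subset_univ _)).trans_lt htot)]
    exact (hy i).2
  rw [not_lt] at htot
  rcases hC.eq_or_lt with rfl | hCpos
  · have hstar : ∀ i, ystar i = 0 := fun i => hempty i (Finset.sum_nonneg fun i _ => hcx i)
    have hcy : ∀ i ∈ Finset.univ, 0 ≤ c i * y i := fun i _ => mul_nonneg (hc i).le (hy i).1
    have hzero := (Finset.sum_eq_zero_iff_of_nonneg hcy).1 (hyC.antisymm (Finset.sum_nonneg hcy))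
    have hy0 : ∀ i, y i = 0 := fun i =>
      (mul_eq_zero.1 (hzero i (Finset.mem_univ i))).resolve_left (hc i).ne'
    simp [hstar, hy0]
  have hex : ∃ k : Fin n, C ≤ ∑ ℓ ∈ Finset.Iic k, c ℓ * x ℓ := by
    refine ⟨⟨n - 1, by omega⟩, htot.trans (hmono fun i _ => ?_)⟩
    rw [Finset.mem_Iic, Fin.le_def]
    exact Nat.le_sub_one_of_lt i.isLt
  obtain ⟨k, hk, hmin⟩ := WellFounded.has_min wellFounded_lt
    {k : Fin n | C ≤ ∑ ℓ ∈ Finset.Iic k, c ℓ * x ℓ} hex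
  rw [Set.mem_ofPred_eq] at hk
  have hbefore : ∀ i, i < k → (∑ ℓ ∈ Finset.Iic i, c ℓ * x ℓ) < C := fun i hi =>
    not_le.1 fun h => hmin i h hi
  have hsplit : ∀ f : Fin n → ℝ, ∑ ℓ ∈ Finset.Iic k, f ℓ = f k + ∑ ℓ ∈ Finset.Iio k, f ℓ := by
    intro f
    rw [← Finset.Iio_insert, Finset.sum_insert Finset.notMem_Iio_self]
  have hprev : (∑ ℓ ∈ Finset.Iio k, c ℓ * x ℓ) < C := by
    rcases Nat.eq_zero_or_pos k.val with h0 | hpos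
    · have : Finset.Iio k = ∅ := by
        refine Finset.eq_empty_of_forall_notMem fun i hi => ?_
        have := Fin.lt_def.1 (Finset.mem_Iio.1 hi)
        omega
      simpa [this] using hCpos
    · refine (hmono fun i hi => ?_).trans_lt
        (hbefore ⟨k.val - 1, by omega⟩ (Fin.lt_def.2 (Nat.sub_one_lt_of_lt hpos)))
      rw [Finset.mem_Iic, Fin.le_def]
      exact Nat.le_sub_one_of_lt (Fin.lt_def.1 (Finset.mem_Iio.1 hi))
  have hxk : x k = 1 := by
    refine (hx k).resolve_left fun h => ?_
    rw [hsplit, h] at hk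
    linarith
  have hstark : c k * ystar k = C - ∑ ℓ ∈ Finset.Iio k, c ℓ * x ℓ := by
    rw [hystar k, if_neg fun h => hk.not_gt h.2, if_pos ⟨hxk, hprev, hk⟩,
      mul_div_cancel₀ _ (hc k).ne']
  have hafter : ∀ i, k < i → ystar i = 0 := fun i hi =>
    hempty i (hk.trans (hmono fun j hj =>
      Finset.mem_Iio.2 ((Finset.mem_Iic.1 hj).trans_lt hi)))
  have hcostprev : ∑ i ∈ Finset.Iio k, c i * ystar i = ∑ i ∈ Finset.Iio k, c i * x i :=
    Finset.sum_congr rfl fun i hi => by rw [hfull i (hbefore i (Finset.mem_Iio.1 hi))]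
  have hcost : ∑ i, c i * ystar i = C := by
    rw [← Finset.sum_subset (Finset.subset_univ (Finset.Iic k)) fun i _ hi => by
      rw [hafter i (by simpa using hi), mul_zero], hsplit, hstark, hcostprev]
    ring
  exact sum_mul_le_of_critical hwbar hc hsort hy (fun i hi => hfull i (hbefore i hi)) hafter
    (hyC.trans hcost.ge)
end

section
/- Assume C > 0. Let (x, y) be a feasible solution of (iK-cs) with x ≠ 0. Then there exist y* ∈ ℝ^n and an index k ∈ {1,…,n} (the fractional index) such that (x, y*) is a feasible solution of (iK-cs) and: (a) y*_i = x_i for all i < k, (b) y*_i = 0 for all i > k, (c) x_k = 1, and (d) 0 < y*_k ≤ 1. -/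
/-- If the ratios `c i / a i` are sorted, `z` is full before `k` and empty after `k`, and `z` costs
at least as much as `y`, then `z` collects at least as much `a`-weight as `y`. -/
lemma sum_mul_le_of_ratio_sorted {ι : Type*} [Fintype ι] [LinearOrder ι]
    {a c x y z : ι → ℝ} {k : ι} (ha : ∀ i, 0 < a i) (hc : ∀ i, 0 < c i)
    (hsort : ∀ i j : ι, i ≤ j → c i / a i ≤ c j / a j)
    (hy : ∀ i, 0 ≤ y i ∧ y i ≤ x i)
    (hlt : ∀ i, i < k → z i = x i) (hgt : ∀ i, k < i → z i = 0)
    (hcost : ∑ i, c i * y i ≤ ∑ i, c i * z i) :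
    ∑ i, a i * y i ≤ ∑ i, a i * z i := by
  have hterm : ∀ i, a k * (c i * (z i - y i)) ≤ c k * (a i * (z i - y i)) := by
    intro i
    rcases lt_trichotomy i k with h | rfl | h
    · have h1 := hsort i k h.le
      rw [div_le_div_iff₀ (ha i) (ha k)] at h1
      have h2 : 0 ≤ z i - y i := by rw [hlt i h]; linarith [(hy i).2]
      nlinarith [mul_le_mul_of_nonneg_right h1 h2]
    · exact le_of_eq (by ring)
    · have h1 := hsort k i h.le
      rw [div_le_div_iff₀ (ha k) (ha i)] at h1
      have h2 : z i - y i ≤ 0 := by rw [hgt i h]; linarith [(hy i).1]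
      nlinarith [mul_le_mul_of_nonpos_right h1 h2]
  have hsum := Finset.sum_le_sum fun i (_ : i ∈ Finset.univ) => hterm i
  simp only [← Finset.mul_sum, mul_sub, Finset.sum_sub_distrib] at hsum
  have h1 := mul_le_mul_of_nonneg_left hcost (ha k).le
  exact le_of_mul_le_mul_left (by linarith) (hc k)

/-- Assume `C > 0`.  Let `(x, y)` be a feasible solution of (iK-cs) with
`x ≠ 0`.  Then there exist `ystar ∈ ℝⁿ` and an index `k` (the fractional index) such that
`(x, ystar)` is feasible for (iK-cs) and (a) `ystar i = x i` for `i < k`, (b) `ystar i = 0`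
for `i > k`, (c) `x k = 1`, (d) `0 < ystar k ≤ 1`. -/
theorem stmt_2 (n : ℕ) (hn : 1 ≤ n)
    (p w wbar c : Fin n → ℝ) (B C : ℝ)
    (hwbar : ∀ i, 0 < wbar i) (hc : ∀ i, 0 < c i) (hC : 0 < C)
    (hsort : ∀ i j : Fin n, i ≤ j → c i / wbar i ≤ c j / wbar j)
    (x y : Fin n → ℝ) (hx : ∀ i, x i = 0 ∨ x i = 1) (hx0 : x ≠ 0)
    (hfeas : (∀ i, 0 ≤ y i ∧ y i ≤ x i) ∧
      (∑ i, w i * x i) - (∑ i, wbar i * y i) ≤ B ∧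
      (∑ i, c i * y i) ≤ C) :
    ∃ (ystar : Fin n → ℝ) (k : Fin n),
      ((∀ i, 0 ≤ ystar i ∧ ystar i ≤ x i) ∧
        (∑ i, w i * x i) - (∑ i, wbar i * ystar i) ≤ B ∧
        (∑ i, c i * ystar i) ≤ C) ∧
      (∀ i, i < k → ystar i = x i) ∧
      (∀ i, k < i → ystar i = 0) ∧
      x k = 1 ∧
      0 < ystar k ∧ ystar k ≤ 1 := by
  classical
  obtain ⟨hy, hB, hyC⟩ := hfeas
  have hx_nonneg : ∀ i, 0 ≤ x i := fun i => (hy i).1.trans (hy i).2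
  obtain ⟨i₀, hi₀⟩ := Function.ne_iff.mp hx0
  let P : Fin n → ℝ := fun i => ∑ j, if j < i then c j * x j else 0
  let S : Finset (Fin n) := Finset.univ.filter fun i => x i = 1
  have hS : S.Nonempty := ⟨i₀, by simpa [S] using (hx i₀).resolve_left hi₀⟩
  let T : Finset (Fin n) := S.filter fun i => P i < C
  have hT : T.Nonempty := by
    refine ⟨S.min' hS, Finset.mem_filter.mpr ⟨S.min'_mem hS, ?_⟩⟩
    have hP : P (S.min' hS) = 0 := by
      refine Finset.sum_eq_zero fun j _ => ?_
      split_ifs with hj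
      · rcases hx j with h | h
        · simp [h]
        · exact absurd (S.min'_le j (by simpa [S] using h)) (not_le.mpr hj)
      · rfl
    rwa [hP]
  let k := T.max' hT
  obtain ⟨hxk, hPk⟩ : x k = 1 ∧ P k < C := by
    have h : k ∈ T := T.max'_mem hT
    simpa [T, S] using h
  have hmax : ∀ i, x i = 1 → k < i → C ≤ P i := by
    intro i hi hki
    by_contra! h
    exact absurd (T.le_max' i (by simpa [T, S] using ⟨hi, h⟩)) (not_le.mpr hki)
  let t : ℝ := min 1 ((C - P k) / c k)
  have ht0 : 0 < t := lt_min one_pos (div_pos (sub_pos.mpr hPk) (hc k))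
  have ht1 : t ≤ 1 := min_le_left _ _
  let z : Fin n → ℝ := fun i => if i < k then x i else if i = k then t else 0
  have hzlt : ∀ i, i < k → z i = x i := fun i h => if_pos h
  have hzk : z k = t := by simp [z]
  have hzgt : ∀ i, k < i → z i = 0 := fun i h => by simp [z, h.not_gt, h.ne']
  have hcost : ∑ i, c i * z i = P k + c k * t := by
    have h : ∀ i, c i * z i =
        (if i < k then c i * x i else 0) + if i = k then c k * t else 0 := by
      intro i
      rcases lt_trichotomy i k with h | h | h
      · simp [hzlt i h, h, h.ne]
      · simp [h, hzk]
      · simp [hzgt i h, h.not_gt, h.ne']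
    simp only [h, Finset.sum_add_distrib, Finset.sum_ite_eq', Finset.mem_univ, if_true, P]
  have hcostC : P k + c k * t ≤ C := by
    have h : t ≤ (C - P k) / c k := min_le_right _ _
    rw [le_div_iff₀ (hc k)] at h
    linarith
  have hz : ∀ i, 0 ≤ z i ∧ z i ≤ x i := by
    intro i
    rcases lt_trichotomy i k with h | h | h
    · rw [hzlt i h]
      exact ⟨hx_nonneg i, le_rfl⟩
    · rw [h, hzk, hxk]
      exact ⟨ht0.le, ht1⟩
    · rw [hzgt i h]
      exact ⟨le_rfl, hx_nonneg i⟩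
  have hycost : ∑ i, c i * y i ≤ ∑ i, c i * z i := by
    rcases hcostC.eq_or_lt with heq | hlt
    · rw [hcost, heq]
      exact hyC
    · have ht : t = 1 := by
        refine ht1.antisymm (le_min le_rfl ?_)
        by_contra! h
        have hteq : t = (C - P k) / c k := min_eq_right h.le
        rw [hteq, mul_div_cancel₀ _ (hc k).ne'] at hlt
        linarith
      have hx_gt : ∀ i, k < i → x i = 0 := by
        by_contra! hne
        let R : Finset (Fin n) := S.filter fun i => k < i
        have hR : R.Nonempty := by
          obtain ⟨i, hki, hi⟩ := hne
          exact ⟨i, by simpa [R, S] using ⟨(hx i).resolve_left hi, hki⟩⟩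
        obtain ⟨hxm, hkm⟩ : x (R.min' hR) = 1 ∧ k < R.min' hR := by
          have h := R.min'_mem hR
          simpa only [R, S, Finset.mem_filter, Finset.mem_univ, true_and] using h
        have hP : P (R.min' hR) = ∑ i, c i * z i := by
          refine Finset.sum_congr rfl fun j _ => ?_
          rcases lt_trichotomy j k with h | h | h
          · rw [if_pos (h.trans hkm), hzlt j h]
          · rw [h, if_pos hkm, hzk, ht, hxk]
          · rw [hzgt j h, mul_zero]
            split_ifs with hj
            · rcases hx j with h0 | h1
              · rw [h0, mul_zero]
              · exact absurd (R.min'_le j (by simpa [R, S] using ⟨h1, h⟩)) (not_le.mpr hj)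
            · rfl
        have := hmax _ hxm hkm
        rw [hP, hcost] at this
        linarith
      refine Finset.sum_le_sum fun i _ => mul_le_mul_of_nonneg_left ?_ (hc i).le
      refine (hy i).2.trans_eq ?_
      rcases lt_trichotomy i k with h | h | h
      · rw [hzlt i h]
      · rw [h, hzk, ht, hxk]
      · rw [hzgt i h, hx_gt i h]
  have hweight := sum_mul_le_of_ratio_sorted hwbar hc hsort hy hzlt hzgt hycost
  exact ⟨z, k, ⟨hz, by linarith, hcost.trans_le hcostC⟩, hzlt, hzgt, hxk,
    by rwa [hzk], by rwa [hzk]⟩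
end

section
/- Assume C > 0 and that (iK-cs) has at least one feasible solution (x,y) with x ≠ 0. Then sup{ Σ_{i=1}^n p_i x_i : (x,y) feasible for (iK-cs), x ≠ 0 } = max over those k ∈ {1,…,n} for which P(k) has a feasible point of ( p_k + sup{ Σ_{i≠k} p_i x_i : (x,y) feasible for P(k) } ). -/
/-- A sum over `Fin n` splits at the index `k`. -/
theorem Fin.sum_eq_sum_Iio_add_add_sum_Ioi {n : ℕ} (f : Fin n → ℝ) (k : Fin n) :
    ∑ i, f i = ∑ i ∈ Finset.Iio k, f i + f k + ∑ i ∈ Finset.Ioi k, f i := by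
  have h : (Finset.univ : Finset (Fin n)) = (Finset.Iio k ∪ {k}) ∪ Finset.Ioi k := by
    ext i
    simp only [Finset.mem_univ, Finset.mem_union, Finset.mem_Iio, Finset.mem_singleton,
      Finset.mem_Ioi, true_iff]
    rcases lt_trichotomy i k with h | h | h <;> simp [h]
  rw [h, Finset.sum_union, Finset.sum_union, Finset.sum_singleton]
  · simp
  · rw [Finset.disjoint_left]
    intro i hi hi'
    simp only [Finset.mem_union, Finset.mem_Iio, Finset.mem_singleton, Finset.mem_Ioi] at hi hi'
    rcases hi with hi | hi
    · exact lt_asymm hi hi'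
    · exact hi'.ne' hi

/-- The vector that agrees with `x` below `k`, equals `t` at `k` and vanishes above `k`. -/
noncomputable def greedyFill {n : ℕ} (k : Fin n) (x : Fin n → ℝ) (t : ℝ) (i : Fin n) : ℝ :=
  if i < k then x i else if i = k then t else 0

theorem sum_mul_greedyFill {n : ℕ} (a : Fin n → ℝ) (k : Fin n) (x : Fin n → ℝ) (t : ℝ) :
    ∑ i, a i * greedyFill k x t i = ∑ i ∈ Finset.Iio k, a i * x i + a k * t := by
  rw [Fin.sum_eq_sum_Iio_add_add_sum_Ioi _ k]
  have h₁ : ∑ i ∈ Finset.Iio k, a i * greedyFill k x t i = ∑ i ∈ Finset.Iio k, a i * x i := by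
    refine Finset.sum_congr rfl fun i hi => ?_
    simp [greedyFill, Finset.mem_Iio.1 hi]
  have h₂ : ∑ i ∈ Finset.Ioi k, a i * greedyFill k x t i = 0 := by
    refine Finset.sum_eq_zero fun i hi => ?_
    have hi := Finset.mem_Ioi.1 hi
    simp [greedyFill, hi.not_gt, hi.ne']
  rw [h₁, h₂]
  simp [greedyFill]

/-- Every nonzero 0/1 vector has a last support element whose predecessors fit in the budget;
if it fits itself, the support ends there. -/
theorem exists_critical_index {n : ℕ} (c x : Fin n → ℝ) (C : ℝ) (hC : 0 ≤ C)
    (hx : ∀ i, x i = 0 ∨ x i = 1) (hx0 : x ≠ 0) :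
    ∃ k, x k = 1 ∧ ∑ i ∈ Finset.Iio k, c i * x i ≤ C ∧
      (∑ i ∈ Finset.Iio k, c i * x i + c k ≤ C → ∀ i, k < i → x i = 0) := by
  classical
  let S := Finset.univ.filter fun i => x i = 1
  let T := S.filter fun k => ∑ i ∈ Finset.Iio k, c i * x i ≤ C
  have hS : S.Nonempty := by
    obtain ⟨i, hi⟩ := Function.ne_iff.1 hx0
    exact ⟨i, by simpa [S] using (hx i).resolve_left hi⟩
  have hT : T.Nonempty := by
    refine ⟨S.min' hS, Finset.mem_filter.2 ⟨S.min'_mem hS, ?_⟩⟩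
    rw [Finset.sum_eq_zero fun i hi => ?_]
    · exact hC
    rcases hx i with h | h
    · simp [h]
    · exact absurd (S.min'_le i (by simpa [S] using h)) (Finset.mem_Iio.1 hi).not_ge
  have hk := Finset.mem_filter.1 (T.max'_mem hT)
  have hmax : ∀ i ∈ T, i ≤ T.max' hT := fun i hi => T.le_max' i hi
  generalize T.max' hT = k at hk hmax
  have hxk : x k = 1 := by simpa [S] using hk.1
  refine ⟨k, hxk, hk.2, fun hfit i hi => (hx i).resolve_right fun hxi => ?_⟩
  let R := S.filter fun j => k < j
  have hR : R.Nonempty := ⟨i, by simp [R, S, hxi, hi]⟩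
  have hm := Finset.mem_filter.1 (R.min'_mem hR)
  have hmin : ∀ j ∈ R, R.min' hR ≤ j := fun j hj => R.min'_le j hj
  generalize R.min' hR = m at hm hmin
  refine (hmax m (Finset.mem_filter.2 ⟨hm.1, ?_⟩)).not_gt hm.2
  refine le_trans (le_of_eq ?_) hfit
  have h : ∑ j ∈ Finset.Iic k, c j * x j = ∑ j ∈ Finset.Iio m, c j * x j := by
    refine Finset.sum_subset (fun j hj => ?_) fun j hj hj' => ?_
    · exact Finset.mem_Iio.2 ((Finset.mem_Iic.1 hj).trans_lt hm.2)
    · rcases hx j with h | h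
      · simp [h]
      · have hkj : k < j := by simpa using hj'
        exact absurd (hmin j (by simp [R, S, h, hkj])) (Finset.mem_Iio.1 hj).not_ge
  rw [← h, ← Finset.Iio_insert, Finset.sum_insert (by simp), hxk]
  ring

/-- Improving the items of a 0/1 vector greedily, in order of increasing cost per unit of
improvement, is at least as good as any other improvement within the budget. -/
theorem exists_greedyFill_dominating {n : ℕ} (wbar c x y : Fin n → ℝ) (C : ℝ)
    (hwbar : ∀ i, 0 < wbar i) (hc : ∀ i, 0 < c i) (hC : 0 ≤ C)
    (hsort : ∀ i j : Fin n, i ≤ j → c i / wbar i ≤ c j / wbar j)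
    (hx : ∀ i, x i = 0 ∨ x i = 1) (hx0 : x ≠ 0) (hy : ∀ i, 0 ≤ y i ∧ y i ≤ x i)
    (hyC : ∑ i, c i * y i ≤ C) :
    ∃ k t, x k = 1 ∧ 0 ≤ t ∧ t ≤ 1 ∧ ∑ i ∈ Finset.Iio k, c i * x i + c k * t ≤ C ∧
      ∑ i, wbar i * y i ≤ ∑ i ∈ Finset.Iio k, wbar i * x i + wbar k * t := by
  obtain ⟨k, hxk, hle, hlast⟩ := exists_critical_index c x C hC hx hx0
  by_cases hfit : ∑ i ∈ Finset.Iio k, c i * x i + c k ≤ C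
  · refine ⟨k, 1, hxk, zero_le_one, le_rfl, by simpa using hfit, ?_⟩
    rw [← sum_mul_greedyFill]
    refine Finset.sum_le_sum fun i _ => mul_le_mul_of_nonneg_left ?_ (hwbar i).le
    have hi := (hy i).2
    rcases lt_trichotomy i k with h | h | h
    · simpa [greedyFill, h] using hi
    · subst h
      simpa [greedyFill, hxk] using hi
    · simpa [greedyFill, h.not_gt, h.ne', hlast hfit i h] using hi
  · set t := (C - ∑ i ∈ Finset.Iio k, c i * x i) / c k with ht
    have hct : c k * t = C - ∑ i ∈ Finset.Iio k, c i * x i := by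
      rw [ht, mul_div_cancel₀ _ (hc k).ne']
    refine ⟨k, t, hxk, div_nonneg (by linarith) (hc k).le, ?_, by linarith, ?_⟩
    · rw [ht, div_le_one (hc k)]
      linarith
    rw [← sum_mul_greedyFill]
    have hz : ∑ i, c i * greedyFill k x t i = C := by
      rw [sum_mul_greedyFill, hct]
      ring
    have hcross : ∀ i j, i ≤ j → c i * wbar j ≤ c j * wbar i := fun i j hij =>
      (div_le_div_iff₀ (hwbar i) (hwbar j)).1 (hsort i j hij)
    have hsum : ∑ i, (c k * wbar i - wbar k * c i) * (y i - greedyFill k x t i) ≤ 0 := by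
      refine Finset.sum_nonpos fun i _ => ?_
      rcases lt_trichotomy i k with h | h | h
      · have h₁ := hcross i k h.le
        refine mul_nonpos_of_nonneg_of_nonpos (by linarith) ?_
        simpa [greedyFill, h] using (hy i).2
      · subst h
        rw [mul_comm (c i), sub_self, zero_mul]
      · have h₁ := hcross k i h.le
        refine mul_nonpos_of_nonpos_of_nonneg (by linarith) ?_
        simpa [greedyFill, h.not_gt, h.ne'] using (hy i).1
    have hexp : ∑ i, (c k * wbar i - wbar k * c i) * (y i - greedyFill k x t i) =
        c k * (∑ i, wbar i * y i - ∑ i, wbar i * greedyFill k x t i) -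
          wbar k * (∑ i, c i * y i - ∑ i, c i * greedyFill k x t i) := by
      simp only [← Finset.sum_sub_distrib, Finset.mul_sum]
      exact Finset.sum_congr rfl fun i _ => by ring
    have h₂ : wbar k * (∑ i, c i * y i - ∑ i, c i * greedyFill k x t i) ≤ 0 :=
      mul_nonpos_of_nonneg_of_nonpos (hwbar k).le (by linarith)
    have h₃ : c k * (∑ i, wbar i * y i - ∑ i, wbar i * greedyFill k x t i) ≤ 0 := by linarith
    have := nonpos_of_mul_nonpos_right h₃ (hc k)
    linarith

theorem sum_mul_le_sum_abs_of_zero_or_one {ι : Type*} (s : Finset ι) (p x : ι → ℝ)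
    (hx : ∀ i ∈ s, x i = 0 ∨ x i = 1) : ∑ i ∈ s, p i * x i ≤ ∑ i ∈ s, |p i| := by
  refine Finset.sum_le_sum fun i hi => ?_
  rcases hx i hi with h | h <;> simp [h, le_abs_self]


/-- Assume `C > 0` and that (iK-cs) has a feasible solution `(x,y)` with
`x ≠ 0`.  Then the supremum of the values of feasible solutions of (iK-cs) with `x ≠ 0`
equals the maximum, over those `k` for which `P(k)` has a feasible point, of
`p k +` (the supremum of the objective values of `P(k)`). -/
theorem stmt_5 (n : ℕ) (hn : 1 ≤ n)
    (p w wbar c : Fin n → ℝ) (B C : ℝ)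
    (hwbar : ∀ i, 0 < wbar i) (hc : ∀ i, 0 < c i) (hC : 0 < C)
    (hsort : ∀ i j : Fin n, i ≤ j → c i / wbar i ≤ c j / wbar j)
    (Feas : (Fin n → ℝ) → (Fin n → ℝ) → Prop)
    (hFeas : ∀ x y, Feas x y ↔ ((∀ i, x i = 0 ∨ x i = 1) ∧
      (∀ i, 0 ≤ y i ∧ y i ≤ x i) ∧
      (∑ i, w i * x i) - (∑ i, wbar i * y i) ≤ B ∧
      (∑ i, c i * y i) ≤ C))
    (PFeas : Fin n → (Fin n → ℝ) → ℝ → Prop)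
    (hPFeas : ∀ k x y, PFeas k x y ↔ ((∀ i, i ≠ k → x i = 0 ∨ x i = 1) ∧
      0 ≤ y ∧ y ≤ 1 ∧
      (∑ i ∈ Finset.Iio k, (w i - wbar i) * x i) + (∑ i ∈ Finset.Ioi k, w i * x i)
        ≤ B - w k + wbar k * y ∧
      (∑ i ∈ Finset.Iio k, c i * x i) ≤ C - c k * y))
    (hex : ∃ x y, Feas x y ∧ x ≠ 0) :
    sSup {v : ℝ | ∃ x y, Feas x y ∧ x ≠ 0 ∧ v = ∑ i, p i * x i} =
      sSup {v : ℝ | ∃ k : Fin n, (∃ x y, PFeas k x y) ∧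
        v = p k + sSup {u : ℝ | ∃ x y, PFeas k x y ∧
          u = ∑ i ∈ Finset.univ.erase k, p i * x i}} := by
  have hsplit : ∀ (k : Fin n) (x : Fin n → ℝ), x k = 1 →
      ∑ i, p i * x i = p k + ∑ i ∈ Finset.univ.erase k, p i * x i := fun k x hk => by
    rw [← Finset.add_sum_erase _ _ (Finset.mem_univ k), hk, mul_one]
  have hbdd : BddAbove {v : ℝ | ∃ x y, Feas x y ∧ x ≠ 0 ∧ v = ∑ i, p i * x i} := by
    refine ⟨∑ i, |p i|, ?_⟩
    rintro v ⟨x, y, hxy, -, rfl⟩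
    exact sum_mul_le_sum_abs_of_zero_or_one _ p x fun i _ => ((hFeas x y).1 hxy).1 i
  have hbddP : ∀ k, BddAbove {u : ℝ | ∃ x y, PFeas k x y ∧
      u = ∑ i ∈ Finset.univ.erase k, p i * x i} := fun k => by
    refine ⟨∑ i ∈ Finset.univ.erase k, |p i|, ?_⟩
    rintro v ⟨x, y, hxy, rfl⟩
    exact sum_mul_le_sum_abs_of_zero_or_one _ p x fun i hi =>
      ((hPFeas k x y).1 hxy).1 i (Finset.ne_of_mem_erase hi)
  have hlift : ∀ k x t, PFeas k x t → ∃ x' y, Feas x' y ∧ x' ≠ 0 ∧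
      p k + ∑ i ∈ Finset.univ.erase k, p i * x i = ∑ i, p i * x' i := by
    intro k x t h
    obtain ⟨hx, ht0, ht1, hw, hcost⟩ := (hPFeas k x t).1 h
    have hlt : ∀ a : Fin n → ℝ, ∑ i ∈ Finset.Iio k, a i * Function.update x k 1 i =
        ∑ i ∈ Finset.Iio k, a i * x i := fun a =>
      Finset.sum_congr rfl fun i hi => by
        rw [Function.update_of_ne (Finset.mem_Iio.1 hi).ne]
    have hgt : ∀ a : Fin n → ℝ, ∑ i ∈ Finset.Ioi k, a i * Function.update x k 1 i =
        ∑ i ∈ Finset.Ioi k, a i * x i := fun a =>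
      Finset.sum_congr rfl fun i hi => by
        rw [Function.update_of_ne (Finset.mem_Ioi.1 hi).ne']
    refine ⟨Function.update x k 1, greedyFill k x t, (hFeas _ _).2 ⟨?_, ?_, ?_, ?_⟩, ?_, ?_⟩
    · intro i
      rcases eq_or_ne i k with rfl | hi
      · simp
      · simpa [hi] using hx i hi
    · intro i
      have hx' : i ≠ k → 0 ≤ x i := fun hi => by
        rcases hx i hi with h | h <;> simp [h]
      rcases lt_trichotomy i k with h | h | h
      · simpa [greedyFill, h, h.ne] using hx' h.ne
      · subst h
        simpa [greedyFill] using And.intro ht0 ht1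
      · simpa [greedyFill, h.not_gt, h.ne'] using hx' h.ne'
    · rw [sum_mul_greedyFill, Fin.sum_eq_sum_Iio_add_add_sum_Ioi _ k, hlt, hgt,
        Function.update_self]
      simp only [sub_mul, Finset.sum_sub_distrib] at hw
      linarith
    · rw [sum_mul_greedyFill]
      linarith
    · exact fun h => by simpa using congrFun h k
    · rw [hsplit k _ (Function.update_self ..)]
      congr 1
      exact Finset.sum_congr rfl fun i hi => by
        rw [Function.update_of_ne (Finset.ne_of_mem_erase hi)]
  have hreduce : ∀ x y, Feas x y → x ≠ 0 → ∃ k t, x k = 1 ∧ PFeas k x t := by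
    intro x y h hx0
    obtain ⟨hx, hy, hw, hcost⟩ := (hFeas x y).1 h
    obtain ⟨k, t, hk, ht0, ht1, hbudget, hdom⟩ :=
      exists_greedyFill_dominating wbar c x y C hwbar hc hC.le hsort hx hx0 hy hcost
    refine ⟨k, t, hk, (hPFeas k x t).2 ⟨fun i _ => hx i, ht0, ht1, ?_, by linarith⟩⟩
    rw [Fin.sum_eq_sum_Iio_add_add_sum_Ioi _ k, hk] at hw
    simp only [sub_mul, Finset.sum_sub_distrib]
    linarith
  have hupper : ∀ v ∈ {v : ℝ | ∃ k : Fin n, (∃ x y, PFeas k x y) ∧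
      v = p k + sSup {u : ℝ | ∃ x y, PFeas k x y ∧
        u = ∑ i ∈ Finset.univ.erase k, p i * x i}},
      v ≤ sSup {v : ℝ | ∃ x y, Feas x y ∧ x ≠ 0 ∧ v = ∑ i, p i * x i} := by
    rintro v ⟨k, ⟨x₀, t₀, h₀⟩, rfl⟩
    rw [← le_sub_iff_add_le']
    refine csSup_le ⟨_, x₀, t₀, h₀, rfl⟩ ?_
    rintro u ⟨x, t, h, rfl⟩
    rw [le_sub_iff_add_le']
    exact le_csSup hbdd (by obtain ⟨x', y, h⟩ := hlift k x t h; exact ⟨x', y, h⟩)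
  obtain ⟨x₀, y₀, h₀, hx₀⟩ := hex
  apply le_antisymm
  · refine csSup_le ⟨_, x₀, y₀, h₀, hx₀, rfl⟩ ?_
    rintro v ⟨x, y, h, hx0, rfl⟩
    obtain ⟨k, t, hk, hP⟩ := hreduce x y h hx0
    rw [hsplit k x hk]
    refine le_trans ?_ (le_csSup ⟨_, hupper⟩ ⟨k, ⟨x, t, hP⟩, rfl⟩)
    gcongr
    exact le_csSup (hbddP k) ⟨x, t, hP, rfl⟩
  · obtain ⟨k, t, -, hP⟩ := hreduce x₀ y₀ h₀ hx₀
    exact csSup_le ⟨_, k, ⟨x₀, t, hP⟩, rfl⟩ hupper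
end

section
/- Fix k ∈ {1,…,n} and assume p_i ≥ 0, 0 ≤ w̄_i ≤ w_i and c_i ≥ 0 for all i. Let (x′, y′) be an optimal solution of P(k) with optimal value OPT(k) = Σ_{i≠k} p_i x′_i, let Q* = {i ≠ k : x′_i = 1}, let q ≥ 1, and let Q⁺ ⊆ Q* with |Q⁺| = q be such that p_i ≤ p̲ := min_{j∈Q⁺} p_j for all i ∈ Q*∖Q⁺. Set Q⁻ = {i ≠ k : i ∉ Q⁺ and p_i > p̲}. Let (x^F, y^F) be an optimal extreme point of the LP relaxation of P(k) (with 0 ≤ x_i ≤ 1 for i ≠ k, 0 ≤ y ≤ 1) with the additional constraints x_i = 1 for i ∈ Q⁺ and x_i = 0 for i ∈ Q⁻, and define x* by x*_i = 1 if x^F_i = 1, and x*_i = 0 otherwise. Then (x*, y^F) is feasible for P(k) and Σ_{i≠k} p_i x*_i ≥ OPT(k) − 2·p̲ ≥ (1 − 2/q)·OPT(k). -/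
open Filter Topology in
/-- A point of the open unit cube (in the coordinates of `s`) can be moved a little along `d`
in both directions without leaving the cube. -/
theorem exists_pos_add_sub_mul_mem_Ioo {ι : Type*} (s : Finset ι) (x d : ι → ℝ)
    (hx : ∀ i ∈ s, x i ∈ Set.Ioo (0 : ℝ) 1) :
    ∃ t : ℝ, 0 < t ∧ ∀ i ∈ s,
      x i + t * d i ∈ Set.Ioo (0 : ℝ) 1 ∧ x i - t * d i ∈ Set.Ioo (0 : ℝ) 1 := by
  have key : ∀ᶠ t : ℝ in 𝓝[>] 0, ∀ i ∈ s,
      x i + t * d i ∈ Set.Ioo (0 : ℝ) 1 ∧ x i - t * d i ∈ Set.Ioo (0 : ℝ) 1 := by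
    refine nhdsWithin_le_nhds ((Finset.eventually_all s).2 fun i hi => ?_)
    have hadd : ContinuousAt (fun t : ℝ => x i + t * d i) 0 := by fun_prop
    have hsub : ContinuousAt (fun t : ℝ => x i - t * d i) 0 := by fun_prop
    exact (hadd.eventually_mem (isOpen_Ioo.mem_nhds (by simpa using hx i hi))).and
      (hsub.eventually_mem (isOpen_Ioo.mem_nhds (by simpa using hx i hi)))
  obtain ⟨t, ht, hpos⟩ := (key.and self_mem_nhdsWithin).exists
  exact ⟨t, hpos, ht⟩

/-- Two homogeneous linear equations have a nonzero solution supported on any given set of more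
than two coordinates. -/
theorem exists_ne_zero_support_sum_mul_eq_zero {ι : Type*} [Fintype ι] (s : Finset ι)
    (hs : 2 < s.card) (a b : ι → ℝ) :
    ∃ d : ι → ℝ, d ≠ 0 ∧ (∀ i, i ∉ s → d i = 0) ∧ ∑ i, a i * d i = 0 ∧ ∑ i, b i * d i = 0 := by
  classical
  have hdep : ¬ LinearIndependent ℝ (fun i : s => (a i, b i)) := fun h => by
    have := h.fintype_card_le_finrank
    simp at this
    omega
  obtain ⟨g, hg, j, hj⟩ := Fintype.not_linearIndependent_iff.1 hdep
  have hsum (v : ι → ℝ) :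
      ∑ i, v i * (if h : i ∈ s then g ⟨i, h⟩ else 0) = ∑ i : s, g i * v i := by
    rw [← Finset.sum_subset s.subset_univ (fun i _ hi => by simp [hi]), ← Finset.sum_coe_sort s]
    exact Finset.sum_congr rfl fun i _ => by simp [mul_comm]
  refine ⟨fun i => if h : i ∈ s then g ⟨i, h⟩ else 0, fun h => hj ?_, fun i hi => by simp [hi],
    ?_, ?_⟩
  · simpa using congrFun h j
  · exact (hsum a).trans (by simpa [Prod.fst_sum] using congrArg Prod.fst hg)
  · exact (hsum b).trans (by simpa [Prod.snd_sum] using congrArg Prod.snd hg)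

/-- If membership of `(x, y)` in `L` is invariant under perturbations of `x` inside the open unit
cube that keep two linear forms fixed, an extreme point of `L` has at most two fractional
coordinates among those of `s`. -/
theorem card_le_two_of_mem_extremePoints {ι : Type*} [Fintype ι] {L : Set ((ι → ℝ) × ℝ)}
    {x : ι → ℝ} {y : ℝ} (hext : (x, y) ∈ L.extremePoints ℝ) (s : Finset ι)
    (hs : ∀ i ∈ s, x i ∈ Set.Ioo (0 : ℝ) 1) (a b : ι → ℝ)
    (hL : ∀ z : ι → ℝ, (∀ i, i ∉ s → z i = x i) → (∀ i ∈ s, z i ∈ Set.Ioo (0 : ℝ) 1) →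
      ∑ i, a i * z i = ∑ i, a i * x i → ∑ i, b i * z i = ∑ i, b i * x i → (z, y) ∈ L) :
    s.card ≤ 2 := by
  by_contra! hcard
  obtain ⟨d, hd, hds, ha, hb⟩ := exists_ne_zero_support_sum_mul_eq_zero s hcard a b
  obtain ⟨t, ht, hmem⟩ := exists_pos_add_sub_mul_mem_Ioo s x d hs
  have hform (v : ι → ℝ) (hv : ∑ i, v i * d i = 0) (r : ℝ) :
      ∑ i, v i * (x i + r * d i) = ∑ i, v i * x i := by
    have hr : ∑ i, v i * (r * d i) = r * ∑ i, v i * d i := by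
      rw [Finset.mul_sum]
      exact Finset.sum_congr rfl fun i _ => by ring
    simp [mul_add, Finset.sum_add_distrib, hr, hv]
  have hplus : ((fun i => x i + t * d i), y) ∈ L :=
    hL _ (fun i hi => by simp [hds i hi]) (fun i hi => (hmem i hi).1) (hform a ha t) (hform b hb t)
  have hminus : ((fun i => x i + -t * d i), y) ∈ L :=
    hL _ (fun i hi => by simp [hds i hi])
      (fun i hi => by simpa [sub_eq_add_neg] using (hmem i hi).2)
      (hform a ha (-t)) (hform b hb (-t))
  have hseg : (x, y) ∈ openSegment ℝ ((fun i => x i + t * d i), y)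
      ((fun i => x i + -t * d i), y) := by
    refine ⟨1 / 2, 1 / 2, by norm_num, by norm_num, by norm_num, ?_⟩
    ext i
    · simp
      ring
    · simp
      ring
  have heq := congrArg Prod.fst (hext.2 hplus hminus hseg)
  refine hd (funext fun i => ?_)
  have hi : x i + t * d i = x i := congrFun heq i
  have : t * d i = 0 := by linarith
  simpa [ht.ne'] using this

/-- Fix `k`, assume `p i ≥ 0`, `0 ≤ w̄ i ≤ w i` and `c i ≥ 0` for all `i`.
Let `(x', y')` be an optimal solution of `P(k)` with optimal value
`OPTk = ∑_{i≠k} p i * x' i`, let `Qstar = {i ≠ k : x' i = 1}`, `q ≥ 1`, `Qplus ⊆ Qstar`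
with `|Qplus| = q` consisting of items of largest profit (every `i ∈ Qstar \ Qplus` has
`p i ≤ pmin := min_{j ∈ Qplus} p j`), and `Qminus = {i ≠ k : i ∉ Qplus ∧ p i > pmin}`.
Let `(xF, yF)` be an optimal extreme point of the LP relaxation of `P(k)` with the added
constraints `x i = 1` on `Qplus` and `x i = 0` on `Qminus` (the coordinate `x k` is pinned
to `0`), and let `xstar` round `xF` down.  Then `(xstar, yF)` is feasible for `P(k)` and
`∑_{i≠k} p i * xstar i ≥ OPTk - 2 pmin ≥ (1 - 2/q) OPTk`. -/
theorem stmt_6 (n : ℕ) (hn : 1 ≤ n)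
    (p w wbar c : Fin n → ℝ) (B C : ℝ) (k : Fin n)
    (hp : ∀ i, 0 ≤ p i) (hw : ∀ i, 0 ≤ wbar i ∧ wbar i ≤ w i) (hc : ∀ i, 0 ≤ c i)
    (PFeas : (Fin n → ℝ) → ℝ → Prop)
    (hPFeas : ∀ x y, PFeas x y ↔ (0 ≤ y ∧ y ≤ 1 ∧
      (∑ i ∈ Finset.Iio k, (w i - wbar i) * x i) + (∑ i ∈ Finset.Ioi k, w i * x i)
        ≤ B - w k + wbar k * y ∧
      (∑ i ∈ Finset.Iio k, c i * x i) ≤ C - c k * y))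
    (x' : Fin n → ℝ) (y' : ℝ)
    (hx'bin : ∀ i, i ≠ k → x' i = 0 ∨ x' i = 1)
    (hx'feas : PFeas x' y')
    (hx'opt : ∀ x y, (∀ i, i ≠ k → x i = 0 ∨ x i = 1) → PFeas x y →
      (∑ i ∈ Finset.univ.erase k, p i * x i) ≤ ∑ i ∈ Finset.univ.erase k, p i * x' i)
    (OPTk : ℝ) (hOPTk : OPTk = ∑ i ∈ Finset.univ.erase k, p i * x' i)
    (Qstar : Finset (Fin n))
    (hQstar : Qstar = Finset.univ.filter (fun i => i ≠ k ∧ x' i = 1))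
    (q : ℕ) (hq : 1 ≤ q)
    (Qplus : Finset (Fin n)) (hQsub : Qplus ⊆ Qstar) (hcard : Qplus.card = q)
    (pmin : ℝ) (hmin1 : ∀ j ∈ Qplus, pmin ≤ p j) (hmin2 : ∃ j ∈ Qplus, p j = pmin)
    (hsmall : ∀ i ∈ Qstar \ Qplus, p i ≤ pmin)
    (Qminus : Finset (Fin n))
    (hQminus : Qminus = Finset.univ.filter (fun i => i ≠ k ∧ i ∉ Qplus ∧ pmin < p i))
    (L : Set ((Fin n → ℝ) × ℝ))
    (hL : L = {z | z.1 k = 0 ∧ (∀ i, i ≠ k → 0 ≤ z.1 i ∧ z.1 i ≤ 1) ∧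
      (∀ i ∈ Qplus, z.1 i = 1) ∧ (∀ i ∈ Qminus, z.1 i = 0) ∧ PFeas z.1 z.2})
    (xF : Fin n → ℝ) (yF : ℝ)
    (hext : (xF, yF) ∈ L.extremePoints ℝ)
    (hLopt : ∀ z ∈ L,
      (∑ i ∈ Finset.univ.erase k, p i * z.1 i) ≤ ∑ i ∈ Finset.univ.erase k, p i * xF i)
    (xstar : Fin n → ℝ) (hxstar : ∀ i, xstar i = if xF i = 1 then 1 else 0) :
    ((∀ i, i ≠ k → xstar i = 0 ∨ xstar i = 1) ∧ PFeas xstar yF) ∧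
      OPTk - 2 * pmin ≤ ∑ i ∈ Finset.univ.erase k, p i * xstar i ∧
      (1 - 2 / (q : ℝ)) * OPTk ≤ OPTk - 2 * pmin := by
  subst hOPTk hQstar hQminus hL
  obtain ⟨j, hjQ, hj⟩ := hmin2
  have hpmin : 0 ≤ pmin := hj ▸ hp j
  have hplus_mem : ∀ i ∈ Qplus, i ≠ k ∧ x' i = 1 := fun i hi => by
    simpa using hQsub hi
  obtain ⟨-, hbox, hone, hzero, hfeas⟩ := hext.1
  dsimp only at hbox hone hzero hfeas
  have hbin : ∀ i, xstar i = 0 ∨ xstar i = 1 := fun i => by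
    rw [hxstar]
    split_ifs <;> simp
  have hle : ∀ i, i ≠ k → xstar i ≤ xF i := fun i hi => by
    rw [hxstar]
    split_ifs with h
    · exact h.ge
    · exact (hbox i hi).1
  have hfrac : (Finset.univ.filter fun i => i ≠ k ∧ xF i ∈ Set.Ioo (0 : ℝ) 1).card ≤ 2 := by
    refine card_le_two_of_mem_extremePoints hext _ (fun i hi => (Finset.mem_filter.1 hi).2.2)
      (fun i => (if i ∈ Finset.Iio k then w i - wbar i else 0) +
        (if i ∈ Finset.Ioi k then w i else 0))
      (fun i => if i ∈ Finset.Iio k then c i else 0) fun z hz hzs hza hzb => ?_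
    simp only [add_mul, ite_mul, zero_mul, Finset.sum_add_distrib, Finset.sum_ite_mem,
      Finset.univ_inter] at hza hzb
    have hz' : ∀ i, xF i = 0 ∨ xF i = 1 ∨ i = k → z i = xF i := fun i hi => hz i (by
      rcases hi with h | h | h <;> simp [h])
    refine ⟨(hz' k (by simp)).trans hext.1.1, fun i hi => ?_,
      fun i hi => (hz' i (by simp [hone i hi])).trans (hone i hi),
      fun i hi => (hz' i (by simp [hzero i hi])).trans (hzero i hi), ?_⟩
    · by_cases his : i ∈ Finset.univ.filter fun i => i ≠ k ∧ xF i ∈ Set.Ioo (0 : ℝ) 1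
      · exact ⟨(hzs i his).1.le, (hzs i his).2.le⟩
      · simpa only [hz i his] using hbox i hi
    · rw [hPFeas] at hfeas ⊢
      dsimp only
      rwa [hza, hzb]
  have hopt : ∑ i ∈ Finset.univ.erase k, p i * x' i ≤ ∑ i ∈ Finset.univ.erase k, p i * xF i := by
    have hsum (s : Finset (Fin n)) (hs : k ∉ s) (v : Fin n → ℝ) :
        ∑ i ∈ s, v i * Function.update x' k 0 i = ∑ i ∈ s, v i * x' i :=
      Finset.sum_congr rfl fun i hi => by
        rw [Function.update_of_ne (ne_of_mem_of_not_mem hi hs)]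
    rw [← hsum _ (by simp)]
    refine hLopt (Function.update x' k 0, y') ⟨by simp, fun i hi => ?_, fun i hi => ?_,
      fun i hi => ?_, ?_⟩
    · rcases hx'bin i hi with h | h <;> simp [hi, h]
    · simp [hplus_mem i hi]
    · simp only [Finset.mem_filter, Finset.mem_univ, true_and] at hi
      obtain ⟨hik, hiQ, hlt⟩ := hi
      rcases hx'bin i hik with h | h
      · simp [hik, h]
      · exact absurd (hsmall i (by simp [hik, h, hiQ])) hlt.not_ge
    · rw [hPFeas] at hx'feas ⊢
      simpa only [hsum (Finset.Iio k) (by simp), hsum (Finset.Ioi k) (by simp)] using hx'feas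
  refine ⟨⟨fun i _ => hbin i, ?_⟩, ?_, ?_⟩
  · rw [hPFeas] at hfeas ⊢
    obtain ⟨hy0, hy1, hweight, hcost⟩ := hfeas
    refine ⟨hy0, hy1, (add_le_add ?_ ?_).trans hweight, le_trans ?_ hcost⟩
    · exact Finset.sum_le_sum fun i hi => mul_le_mul_of_nonneg_left
        (hle i (Finset.mem_Iio.1 hi).ne) (sub_nonneg.2 (hw i).2)
    · exact Finset.sum_le_sum fun i hi => mul_le_mul_of_nonneg_left
        (hle i (Finset.mem_Ioi.1 hi).ne') ((hw i).1.trans (hw i).2)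
    · exact Finset.sum_le_sum fun i hi => mul_le_mul_of_nonneg_left
        (hle i (Finset.mem_Iio.1 hi).ne) (hc i)
  · have hloss : ∑ i ∈ Finset.univ.erase k, p i * xF i ≤
        ∑ i ∈ Finset.univ.erase k, (p i * xstar i +
          if xF i ∈ Set.Ioo (0 : ℝ) 1 then pmin else 0) := by
      refine Finset.sum_le_sum fun i hi => ?_
      have hik : i ≠ k := Finset.ne_of_mem_erase hi
      obtain ⟨h0, h1⟩ := hbox i hik
      rw [hxstar]
      rcases h0.eq_or_lt with h0 | h0
      · simp [← h0]
      rcases h1.eq_or_lt with h1 | h1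
      · simp [h1]
      have hpi : p i ≤ pmin := by
        by_contra! hlt
        have hiQ : i ∉ Qplus := fun h => h1.ne (hone i h)
        exact h0.ne' (hzero i (by simp [hik, hiQ, hlt]))
      have : p i * xF i ≤ p i := mul_le_of_le_one_right (hp i) h1.le
      simp [h0, h1, h1.ne]
      linarith
    have hcount : (∑ i ∈ Finset.univ.erase k, if xF i ∈ Set.Ioo (0 : ℝ) 1 then pmin else 0) ≤
        2 * pmin := by
      have hset : ((Finset.univ.erase k).filter fun i => xF i ∈ Set.Ioo (0 : ℝ) 1) =
          Finset.univ.filter fun i => i ≠ k ∧ xF i ∈ Set.Ioo (0 : ℝ) 1 := by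
        ext i
        simp
      rw [← Finset.sum_filter, hset, Finset.sum_const, nsmul_eq_mul]
      exact mul_le_mul_of_nonneg_right (by exact_mod_cast hfrac) hpmin
    rw [Finset.sum_add_distrib] at hloss
    linarith
  · have hq0 : (0 : ℝ) < q := by exact_mod_cast hq
    have hbound : q * pmin ≤ ∑ i ∈ Finset.univ.erase k, p i * x' i := calc
      q * pmin = ∑ i ∈ Qplus, pmin := by simp [hcard]
      _ ≤ ∑ i ∈ Qplus, p i * x' i := Finset.sum_le_sum fun i hi => by
        simpa [hplus_mem i hi] using hmin1 i hi
      _ ≤ ∑ i ∈ Finset.univ.erase k, p i * x' i :=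
        Finset.sum_le_sum_of_subset_of_nonneg (fun i hi => by simp [hplus_mem i hi])
          fun i hi _ => by
            rcases hx'bin i (Finset.ne_of_mem_erase hi) with h | h <;> simp [h, hp i]
    have hdiv : pmin ≤ (∑ i ∈ Finset.univ.erase k, p i * x' i) / q := by
      rw [le_div_iff₀ hq0]
      linarith
    rw [sub_mul, one_mul, div_mul_eq_mul_div, mul_div_assoc]
    linarith
end

section
/- Assume 0 ≤ ŵ_i ≤ w_i for all i. Then iK-ds* ≤ 2·max{ MKP*(ŵ,c), KP*(w) }. -/
/-- Assume `0 ≤ ŵ i ≤ w i` for all `i`.  Then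
`iK-ds* ≤ 2 * max (MKP*(ŵ,c)) (KP*(w))`. -/
theorem stmt_7 (n : ℕ) (hn : 1 ≤ n)
    (p w what c : Fin n → ℝ) (B C : ℝ)
    (hp : ∀ i, 0 ≤ p i) (hw : ∀ i, 0 ≤ what i ∧ what i ≤ w i)
    (hc : ∀ i, 0 ≤ c i) (hB : 0 ≤ B) (hC : 0 ≤ C)
    (iKopt MKPopt KPopt : ℝ)
    (hiK : IsGreatest {v : ℝ | ∃ x xhat : Fin n → ℝ,
      (∀ i, (x i = 0 ∨ x i = 1) ∧ (xhat i = 0 ∨ xhat i = 1) ∧ x i + xhat i ≤ 1) ∧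
      (∑ i, w i * x i) + (∑ i, what i * xhat i) ≤ B ∧
      (∑ i, c i * xhat i) ≤ C ∧
      v = ∑ i, p i * (x i + xhat i)} iKopt)
    (hMKP : IsGreatest {v : ℝ | ∃ x : Fin n → ℝ, (∀ i, x i = 0 ∨ x i = 1) ∧
      (∑ i, what i * x i) ≤ B ∧ (∑ i, c i * x i) ≤ C ∧
      v = ∑ i, p i * x i} MKPopt)
    (hKP : IsGreatest {v : ℝ | ∃ x : Fin n → ℝ, (∀ i, x i = 0 ∨ x i = 1) ∧
      (∑ i, w i * x i) ≤ B ∧ v = ∑ i, p i * x i} KPopt) :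
    iKopt ≤ 2 * max MKPopt KPopt := by
  obtain ⟨⟨x, xhat, hx, hweight, hcost, rfl⟩, -⟩ := hiK
  have nonneg_of_binary : ∀ {a : ℝ}, a = 0 ∨ a = 1 → 0 ≤ a := by
    rintro a (rfl | rfl) <;> norm_num
  have hwx : 0 ≤ ∑ i, w i * x i := Finset.sum_nonneg fun i _ =>
    mul_nonneg ((hw i).1.trans (hw i).2) (nonneg_of_binary (hx i).1)
  have hwxhat : 0 ≤ ∑ i, what i * xhat i := Finset.sum_nonneg fun i _ =>
    mul_nonneg (hw i).1 (nonneg_of_binary (hx i).2.1)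
  have hKP_le : ∑ i, p i * x i ≤ KPopt :=
    hKP.2 ⟨x, fun i => (hx i).1, by linarith, rfl⟩
  have hMKP_le : ∑ i, p i * xhat i ≤ MKPopt :=
    hMKP.2 ⟨xhat, fun i => (hx i).2.1, by linarith, hcost, rfl⟩
  simp only [mul_add, Finset.sum_add_distrib]
  linarith [le_max_left MKPopt KPopt, le_max_right MKPopt KPopt]
end

section
/- For every i ∈ {1,…,n}, every q ∈ ℝ and every r, the minimum-weight function of (iK-dm) satisfies the recurrence W(i, q, r) = min( W(i−1, q, r), min_{0 ≤ ℓ ≤ j(i)} ( W(i−1, q − c_i^ℓ, r − p_i) + w_i^ℓ ) ), where the outer and inner minima are taken in ℝ ∪ {+∞}. -/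
/-- For every item `i`, every `q ∈ ℝ` and every profit value `r`, the
minimum-weight function `W` of (iK-dm) satisfies the recurrence
`W (i+1) q r = min (W i q r) (min_{0 ≤ ℓ ≤ j i} (W i (q - c i ℓ) (r - p i) + w i ℓ))`,
where the minima are taken in `ℝ ∪ {+∞}` (modelled by `EReal`; all the sets occurring are
finite, and the empty infimum is `+∞`).  Items are indexed by `Fin n`; `W m q r` is the
infimum of total weights of packings using only items of index `< m`. -/
theorem stmt_8 (n : ℕ) (p : Fin n → ℝ) (j : Fin n → ℕ)
    (w c : Fin n → ℕ → ℝ)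
    (hwmono : ∀ (i : Fin n) (ℓ : ℕ), ℓ < j i → w i (ℓ + 1) ≤ w i ℓ)
    (hc0 : ∀ i, c i 0 = 0)
    (hcmono : ∀ (i : Fin n) (ℓ : ℕ), ℓ < j i → c i ℓ ≤ c i (ℓ + 1))
    (W : ℕ → ℝ → ℝ → EReal)
    (hW : ∀ (m : ℕ) (q r : ℝ), W m q r =
      sInf {v : EReal | ∃ (S : Finset (Fin n)) (ℓ : Fin n → ℕ),
        (∀ s ∈ S, (s : ℕ) < m) ∧ (∀ s ∈ S, ℓ s ≤ j s) ∧
        (∑ s ∈ S, c s (ℓ s)) ≤ q ∧ (∑ s ∈ S, p s) = r ∧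
        v = ((∑ s ∈ S, w s (ℓ s) : ℝ) : EReal)}) :
    ∀ (i : Fin n) (q r : ℝ),
      W ((i : ℕ) + 1) q r =
        min (W (i : ℕ) q r)
          (⨅ ℓ ∈ Finset.range (j i + 1),
            (W (i : ℕ) (q - c i ℓ) (r - p i) + ((w i ℓ : ℝ) : EReal))) := by
  intro i q r
  have packing_le : ∀ (m : ℕ) (q : ℝ) (S : Finset (Fin n)) (ℓ : Fin n → ℕ),
      (∀ s ∈ S, (s : ℕ) < m) → (∀ s ∈ S, ℓ s ≤ j s) → (∑ s ∈ S, c s (ℓ s)) ≤ q →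
      W m q (∑ s ∈ S, p s) ≤ ((∑ s ∈ S, w s (ℓ s) : ℝ) : EReal) := by
    intro m q S ℓ hm hj hq
    rw [hW]
    exact sInf_le ⟨S, ℓ, hm, hj, hq, rfl, rfl⟩
  apply le_antisymm
  · refine le_min ?_ (le_iInf₂ fun k hk => ?_)
    · rw [hW i q r]
      refine le_sInf ?_
      rintro v ⟨S, ℓ, hm, hj, hq, rfl, rfl⟩
      exact packing_le _ _ S ℓ (fun s hs => (hm s hs).trans (Nat.lt_succ_self _)) hj hq
    · have hk' : k ≤ j i := by simpa [Nat.lt_succ_iff] using hk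
      rw [← EReal.sub_le_iff_le_add (Or.inl (EReal.coe_ne_bot _)) (Or.inl (EReal.coe_ne_top _)),
        hW i (q - c i k) (r - p i)]
      refine le_sInf ?_
      rintro v ⟨S, ℓ, hm, hj, hq, hr, rfl⟩
      rw [EReal.sub_le_iff_le_add (Or.inl (EReal.coe_ne_bot _)) (Or.inl (EReal.coe_ne_top _)),
        ← EReal.coe_add]
      have hi : i ∉ S := fun h => (hm i h).false
      have hne : ∀ s ∈ S, s ≠ i := fun s hs h => hi (h ▸ hs)
      have hsum : ∀ f : Fin n → ℕ → ℝ, ∑ s ∈ insert i S, f s (Function.update ℓ i k s) =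
          ∑ s ∈ S, f s (ℓ s) + f i k := by
        intro f
        rw [Finset.sum_insert hi, Function.update_self, add_comm]
        congr 1
        exact Finset.sum_congr rfl fun s hs => by rw [Function.update_of_ne (hne s hs)]
      have hle := packing_le (i + 1) q (insert i S) (Function.update ℓ i k) ?_ ?_ ?_
      · rwa [hsum w, Finset.sum_insert hi, hr, add_sub_cancel] at hle
      · intro s hs
        rcases Finset.mem_insert.1 hs with rfl | hs
        · exact Nat.lt_succ_self _
        · exact (hm s hs).trans (Nat.lt_succ_self _)
      · intro s hs
        rcases Finset.mem_insert.1 hs with rfl | hs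
        · rwa [Function.update_self]
        · rw [Function.update_of_ne (hne s hs)]
          exact hj s hs
      · rw [hsum c]
        linarith
  · rw [hW (i + 1) q r]
    refine le_sInf ?_
    rintro v ⟨S, ℓ, hm, hj, hq, rfl, rfl⟩
    by_cases hi : i ∈ S
    · refine (min_le_right _ _).trans ((iInf₂_le (ℓ i)
        (Finset.mem_range.2 (Nat.lt_succ_of_le (hj i hi)))).trans ?_)
      have hp := Finset.sum_erase_add S p hi
      have hc := Finset.sum_erase_add S (fun s => c s (ℓ s)) hi
      rw [← Finset.sum_erase_add S (fun s => w s (ℓ s)) hi, EReal.coe_add, ← hp,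
        add_sub_cancel_right]
      gcongr
      refine packing_le _ _ (S.erase i) ℓ (fun s hs => ?_)
        (fun s hs => hj s (Finset.mem_of_mem_erase hs)) (by linarith)
      have hlt := hm s (Finset.mem_of_mem_erase hs)
      have hne := Fin.val_ne_of_ne (Finset.ne_of_mem_erase hs)
      omega
    · refine (min_le_left _ _).trans (packing_le _ _ S ℓ (fun s hs => ?_) hj hq)
      have hlt := hm s hs
      have hne : (s : ℕ) ≠ i := Fin.val_ne_of_ne fun h => hi (h ▸ hs)
      omega
end

section
/- Assume p_i ≥ 0 for all i, p_max := max_i p_i > 0, ε > 0, and that a maximum-profit item can be packed alone, i.e., there exist i* with p_{i*} = p_max and a level ℓ with w_{i*}^ℓ ≤ B and c_{i*}^ℓ ≤ C. Set K = ε·p_max/n and p′_i = ⌊p_i/K⌋. If (S, ℓ) is an optimal solution of the (iK-dm) instance obtained by replacing the profits p by p′ (same weights, costs and budgets), then Σ_{s∈S} p_s ≥ (1 − ε)·OPT, where OPT is the optimal value of the original (iK-dm) instance with profits p. -/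
/-- Assume `p i ≥ 0` for all `i`, `pmax = max_i p i > 0`, `ε > 0`, and
that a maximum-profit item can be packed alone.  Set `K = ε * pmax / n` and
`p' i = ⌊p i / K⌋`.  If `(S, ℓ)` is an optimal solution of the (iK-dm) instance with
profits `p'` (same weights, costs and budgets), then `∑_{s∈S} p s ≥ (1 - ε) * OPT`,
where `OPT` is the optimal value of the original instance. -/
theorem stmt_10 (n : ℕ) (hn : 1 ≤ n)
    (p : Fin n → ℝ) (j : Fin n → ℕ) (w c : Fin n → ℕ → ℝ) (B C : ℝ)
    (hp : ∀ i, 0 ≤ p i)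
    (hwmono : ∀ (i : Fin n) (ℓ : ℕ), ℓ < j i → w i (ℓ + 1) ≤ w i ℓ)
    (hc0 : ∀ i, c i 0 = 0)
    (hcmono : ∀ (i : Fin n) (ℓ : ℕ), ℓ < j i → c i ℓ ≤ c i (ℓ + 1))
    (pmax : ℝ) (hpmaxub : ∀ i, p i ≤ pmax) (hpmaxpos : 0 < pmax)
    (istar : Fin n) (ℓstar : ℕ)
    (h1 : p istar = pmax) (h2 : ℓstar ≤ j istar)
    (h3 : w istar ℓstar ≤ B) (h4 : c istar ℓstar ≤ C)
    (ε : ℝ) (hε : 0 < ε)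
    (K : ℝ) (hK : K = ε * pmax / n)
    (p' : Fin n → ℕ) (hp' : ∀ i, p' i = ⌊p i / K⌋₊)
    (Feas : Finset (Fin n) → (Fin n → ℕ) → Prop)
    (hFeas : ∀ S ℓ, Feas S ℓ ↔ ((∀ s ∈ S, ℓ s ≤ j s) ∧
      (∑ s ∈ S, w s (ℓ s)) ≤ B ∧ (∑ s ∈ S, c s (ℓ s)) ≤ C))
    (S : Finset (Fin n)) (ℓ : Fin n → ℕ) (hSfeas : Feas S ℓ)
    (hSopt : ∀ S' ℓ', Feas S' ℓ' → (∑ s ∈ S', p' s) ≤ ∑ s ∈ S, p' s)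
    (OPT : ℝ)
    (hOPT : IsGreatest {v : ℝ | ∃ S' ℓ', Feas S' ℓ' ∧ v = ∑ s ∈ S', p s} OPT) :
    (1 - ε) * OPT ≤ ∑ s ∈ S, p s := by
  have hn' : (0 : ℝ) < n := by exact_mod_cast hn
  have hKpos : 0 < K := by rw [hK]; positivity
  have hKn : K * n = ε * pmax := by rw [hK]; field_simp
  obtain ⟨⟨T, m, hT, hOPTeq⟩, hub⟩ := hOPT
  have hmax : pmax ≤ OPT := by
    refine hub ⟨{istar}, fun _ => ℓstar, (hFeas _ _).2 ⟨?_, ?_, ?_⟩, ?_⟩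
    · simpa using h2
    · simpa using h3
    · simpa using h4
    · simp [h1]
  have hlower : ∀ i, K * (p' i : ℝ) ≤ p i := fun i => by
    rw [hp' i, mul_comm, ← le_div_iff₀ hKpos]
    exact Nat.floor_le (div_nonneg (hp i) hKpos.le)
  have hupper : ∀ i, p i ≤ K * ((p' i : ℝ) + 1) := fun i => by
    rw [hp' i, mul_comm, ← div_le_iff₀ hKpos]
    exact (Nat.lt_floor_add_one _).le
  have hrounded : (∑ s ∈ T, (p' s : ℝ)) ≤ ∑ s ∈ S, (p' s : ℝ) := by
    exact_mod_cast hSopt T m hT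
  have hcard : (T.card : ℝ) ≤ n := by
    exact_mod_cast (Finset.card_le_univ T).trans_eq (Fintype.card_fin n)
  have hloss : OPT ≤ (∑ s ∈ S, p s) + ε * pmax :=
    calc OPT = ∑ s ∈ T, p s := hOPTeq
      _ ≤ ∑ s ∈ T, K * ((p' s : ℝ) + 1) := Finset.sum_le_sum fun i _ => hupper i
      _ = K * ∑ s ∈ T, (p' s : ℝ) + K * T.card := by
        rw [← Finset.mul_sum, Finset.sum_add_distrib]
        simp [mul_add]
      _ ≤ K * ∑ s ∈ S, (p' s : ℝ) + K * n := by gcongr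
      _ ≤ (∑ s ∈ S, p s) + ε * pmax := by
        rw [hKn, Finset.mul_sum]
        gcongr with i _
        exact hlower i
  linarith [mul_le_mul_of_nonneg_left hmax hε.le]
end

section
/- Every extreme point (x, y) of the LP relaxation polytope P_LP of (iK-dm) has at most two non-integral items, i.e., the set of indices i for which the block (x_i, y_i^1, …, y_i^{j(i)}) is not contained in {0,1}^{j(i)+1} has at most two elements. -/
/-- Moving `a` by at most its distance to `{0, 1}` keeps it in the unit interval. -/
lemma add_mul_min_mem_Icc {a t : ℝ} (ht : |t| ≤ 1) (ha : a ∈ Set.Icc (0 : ℝ) 1) :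
    a + t * min a (1 - a) ∈ Set.Icc (0 : ℝ) 1 := by
  obtain ⟨h1, h2⟩ := abs_le.mp ht
  obtain ⟨h3, h4⟩ := ha
  have hm : 0 ≤ min a (1 - a) := le_min h3 (by linarith)
  constructor
  · nlinarith [min_le_left a (1 - a)]
  · nlinarith [min_le_right a (1 - a)]

lemma add_mul_min_le_add_mul_min {a b t : ℝ} (ht : |t| ≤ 1) (hab : a ≤ b) :
    a + t * min a (1 - a) ≤ b + t * min b (1 - b) := by
  obtain ⟨h1, h2⟩ := abs_le.mp ht
  rcases min_cases a (1 - a) with ⟨h, h'⟩ | ⟨h, h'⟩ <;>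
    rcases min_cases b (1 - b) with ⟨k, k'⟩ | ⟨k, k'⟩ <;> rw [h, k] <;> nlinarith

lemma min_one_sub_eq_zero {a : ℝ} (h : min a (1 - a) = 0) : a = 0 ∨ a = 1 := by
  rcases min_choice a (1 - a) with k | k
  · left; linarith
  · right; linarith

/-- More than two planar vectors satisfy a nontrivial linear relation, with coefficients of
absolute value at most one. -/
lemma exists_relation_abs_le_one {ι : Type*} [Fintype ι] {S : Finset ι} (hS : 2 < S.card)
    (u v : ι → ℝ) :
    ∃ t : ι → ℝ, (∀ i, |t i| ≤ 1) ∧ (∑ i, t i * u i = 0) ∧ (∑ i, t i * v i = 0) ∧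
      ∃ i ∈ S, t i ≠ 0 := by
  classical
  have hdep : ¬ LinearIndepOn ℝ (fun i => (u i, v i)) (S : Set ι) := by
    intro h
    have := LinearIndependent.fintype_card_le_finrank h
    simp at this
    omega
  obtain ⟨f, hf, i₀, hi₀, hne⟩ := not_linearIndepOn_finset_iff.mp hdep
  have hu : ∑ i ∈ S, f i * u i = 0 := by
    simpa [Prod.fst_sum] using congrArg Prod.fst hf
  have hv : ∑ i ∈ S, f i * v i = 0 := by
    simpa [Prod.snd_sum] using congrArg Prod.snd hf
  set M := ∑ i ∈ S, |f i|
  have hM : ∀ i ∈ S, |f i| ≤ M := fun i hi =>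
    Finset.single_le_sum (f := fun i => |f i|) (fun _ _ => abs_nonneg _) hi
  have hM0 : 0 < M := (abs_pos.mpr hne).trans_le (hM i₀ hi₀)
  have hrel : ∀ g : ι → ℝ, ∑ i ∈ S, f i * g i = 0 →
      ∑ i, (if i ∈ S then f i / M else 0) * g i = 0 := by
    intro g hg
    simp only [ite_mul, zero_mul, Finset.sum_ite_mem, Finset.univ_inter, div_mul_eq_mul_div]
    rw [← Finset.sum_div, hg, zero_div]
  refine ⟨fun i => if i ∈ S then f i / M else 0, fun i => ?_, hrel u hu, hrel v hv,
    i₀, hi₀, by simp [hi₀, hne, hM0.ne']⟩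
  by_cases hi : i ∈ S
  · simpa [hi, abs_div, abs_of_pos hM0, div_le_one hM0] using hM i hi
  · simp [hi]

/-- Every extreme point `(x, y)` of the LP relaxation polytope `P_LP`
of (iK-dm) has at most two non-integral items, i.e. the set of indices `i` for which the
block `(x i, y i 0, …, y i (j i - 1))` is not contained in `{0,1}` has at most two
elements.  Here `y i ℓ` (with `ℓ : Fin (j i)`) models the variable `y_i^{ℓ+1}` of level
`ℓ+1`, and `w i ℓ`, `c i ℓ` are the weight and cost of item `i` at improvement level `ℓ`. -/
theorem stmt_11 (n : ℕ) (j : Fin n → ℕ)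
    (p : Fin n → ℝ) (w c : Fin n → ℕ → ℝ) (B C : ℝ)
    (hwmono : ∀ (i : Fin n) (ℓ : ℕ), ℓ < j i → w i (ℓ + 1) ≤ w i ℓ)
    (hc0 : ∀ i, c i 0 = 0)
    (hcmono : ∀ (i : Fin n) (ℓ : ℕ), ℓ < j i → c i ℓ ≤ c i (ℓ + 1))
    (PLP : Set ((Fin n → ℝ) × ((i : Fin n) → Fin (j i) → ℝ)))
    (hPLP : PLP = {z | (∀ i, 0 ≤ z.1 i ∧ z.1 i ≤ 1) ∧
      (∀ (i : Fin n) (ℓ : Fin (j i)), 0 ≤ z.2 i ℓ) ∧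
      (∀ (i : Fin n) (ℓ : Fin (j i)), z.2 i ℓ ≤ z.1 i) ∧
      (∀ (i : Fin n) (ℓ ℓ' : Fin (j i)), ℓ ≤ ℓ' → z.2 i ℓ' ≤ z.2 i ℓ) ∧
      (∑ i, w i 0 * z.1 i)
        + (∑ i, ∑ ℓ : Fin (j i), (w i ((ℓ : ℕ) + 1) - w i (ℓ : ℕ)) * z.2 i ℓ) ≤ B ∧
      (∑ i, ∑ ℓ : Fin (j i), (c i ((ℓ : ℕ) + 1) - c i (ℓ : ℕ)) * z.2 i ℓ) ≤ C})
    (z : (Fin n → ℝ) × ((i : Fin n) → Fin (j i) → ℝ))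
    (hz : z ∈ PLP.extremePoints ℝ) :
    {i : Fin n | ¬ ((z.1 i = 0 ∨ z.1 i = 1) ∧
      ∀ ℓ : Fin (j i), z.2 i ℓ = 0 ∨ z.2 i ℓ = 1)}.ncard ≤ 2 := by
  classical
  by_contra hcard
  rw [not_le, Set.ncard_eq_toFinset_card'] at hcard
  let d : ℝ → ℝ := fun a => min a (1 - a)
  obtain ⟨t, ht, hu, hv, i, hi, hti⟩ := exists_relation_abs_le_one hcard
    (fun i => w i 0 * d (z.1 i) +
      ∑ ℓ : Fin (j i), (w i ((ℓ : ℕ) + 1) - w i (ℓ : ℕ)) * d (z.2 i ℓ))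
    (fun i => ∑ ℓ : Fin (j i), (c i ((ℓ : ℕ) + 1) - c i (ℓ : ℕ)) * d (z.2 i ℓ))
  obtain ⟨hzP, hext⟩ := hz
  rw [hPLP] at hzP
  obtain ⟨hx, hy0, hyx, hyy, hB, hC⟩ := hzP
  let q : ℝ → (Fin n → ℝ) × ((i : Fin n) → Fin (j i) → ℝ) := fun s =>
    (fun i => z.1 i + s * t i * d (z.1 i), fun i ℓ => z.2 i ℓ + s * t i * d (z.2 i ℓ))
  have hq : ∀ s : ℝ, |s| ≤ 1 → q s ∈ PLP := fun s hs => by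
    rw [hPLP]
    have hst : ∀ i, |s * t i| ≤ 1 := fun i => by
      rw [abs_mul]; exact mul_le_one₀ hs (abs_nonneg _) (ht i)
    refine ⟨fun i => add_mul_min_mem_Icc (hst i) (hx i),
      fun i ℓ => (add_mul_min_mem_Icc (hst i) ⟨hy0 i ℓ, (hyx i ℓ).trans (hx i).2⟩).1,
      fun i ℓ => add_mul_min_le_add_mul_min (hst i) (hyx i ℓ),
      fun i ℓ ℓ' h => add_mul_min_le_add_mul_min (hst i) (hyy i ℓ ℓ' h), ?_, ?_⟩
    · refine le_of_eq_of_le ?_ hB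
      conv_rhs => rw [← add_zero (_ + _), ← mul_zero s, ← hu, Finset.mul_sum]
      simp only [← Finset.sum_add_distrib]
      refine Finset.sum_congr rfl fun i _ => ?_
      simp only [q, mul_add, Finset.sum_add_distrib, Finset.mul_sum]
      simp only [mul_left_comm, mul_assoc]
      ring
    · refine le_of_eq_of_le ?_ hC
      conv_rhs => rw [← add_zero (∑ i, _), ← mul_zero s, ← hv, Finset.mul_sum]
      rw [← Finset.sum_add_distrib]
      refine Finset.sum_congr rfl fun i _ => ?_
      simp only [q, mul_add, Finset.sum_add_distrib, Finset.mul_sum]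
      simp only [mul_left_comm, mul_assoc]
  have hmid : z ∈ openSegment ℝ (q 1) (q (-1)) := by
    refine ⟨1 / 2, 1 / 2, by norm_num, by norm_num, by norm_num, ?_⟩
    ext <;> simp [q] <;> ring
  have hz1 : q 1 = z := hext (hq 1 (by simp)) (hq (-1) (by simp)) hmid
  have key : ∀ a : ℝ, a + 1 * t i * d a = a → a = 0 ∨ a = 1 := fun a h =>
    min_one_sub_eq_zero (by simpa [hti] using h)
  simp only [Set.mem_toFinset, Set.mem_ofPred_eq] at hi
  exact hi ⟨key _ (congrFun (congrArg Prod.fst hz1) i),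
    fun ℓ => key _ (congrFun (congrFun (congrArg Prod.snd hz1) i) ℓ)⟩
end

section
/- Assume p_i ≥ 0 and w_i^{j(i)} ≥ 0 for all i, B ≥ 0, C ≥ 0, and that every item can be packed alone, i.e., for every i there exists a level ℓ_i with w_i^{ℓ_i} ≤ B and c_i^{ℓ_i} ≤ C. Let (x, y) be an extreme point of the LP relaxation polytope P_LP of (iK-dm) with Σ_i p_i x_i ≥ OPT, where OPT is the optimal value of (iK-dm). Let J = { i : (x_i, y_i^1,…,y_i^{j(i)}) ∈ {0,1}^{j(i)+1} and x_i = 1 } with levels ℓ(i) = max{ ℓ : y_i^ℓ = 1 } (ℓ(i) = 0 if y_i^ℓ = 0 for all ℓ), and let F be the set of items whose block is not integral. Then: (i) packing exactly the items of J at levels ℓ(i) is a feasible solution of (iK-dm); (ii) for each f ∈ F, packing f alone at level ℓ_f is a feasible solution of (iK-dm); (iii) Σ_{i∈J} p_i + Σ_{f∈F} p_f ≥ OPT; consequently, since |F| ≤ 2, the best of these at most three feasible solutions has value at least OPT/3. -/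
open Filter Topology in
/-- Moving exactly the numbers equal to `v` by a small common amount preserves a weak inequality. -/
lemma eventually_shift_le_shift (a v : ℝ) {u u' : ℝ} (h : u ≤ u') :
    ∀ᶠ t : ℝ in 𝓝 0, u + t * (a * if u = v then 1 else 0) ≤
      u' + t * (a * if u' = v then 1 else 0) := by
  rcases h.eq_or_lt with rfl | h
  · simp
  · have hu : Tendsto (fun t : ℝ => u + t * (a * if u = v then 1 else 0)) (𝓝 0) (𝓝 u) := by
      apply Continuous.tendsto' (by fun_prop)
      simp
    have hu' : Tendsto (fun t : ℝ => u' + t * (a * if u' = v then 1 else 0)) (𝓝 0) (𝓝 u') := by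
      apply Continuous.tendsto' (by fun_prop)
      simp
    exact (hu.eventually_lt hu' h).mono fun t ht => ht.le

/-- Two linear equations in more than two unknowns, indexed by a finset, have a nontrivial
solution. -/
lemma exists_ne_zero_sum_mul_eq_zero {ι : Type*} [Fintype ι] [DecidableEq ι] (F : Finset ι)
    (hF : 2 < F.card) (α β : ι → ℝ) :
    ∃ a : ι → ℝ, (∃ i ∈ F, a i ≠ 0) ∧ (∀ i ∉ F, a i = 0) ∧
      ∑ i, a i * α i = 0 ∧ ∑ i, a i * β i = 0 := by
  have hli : ¬ LinearIndependent ℝ (fun i : F => ((α i, β i) : ℝ × ℝ)) := by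
    intro h
    have hcard := h.fintype_card_le_finrank
    simp at hcard
    omega
  obtain ⟨g, hg, i₀, hi₀⟩ := Fintype.not_linearIndependent_iff.1 hli
  have hsum : ∀ γ : ι → ℝ,
      ∑ i, (if h : i ∈ F then g ⟨i, h⟩ else 0) * γ i = ∑ i : F, g i * γ i := by
    intro γ
    rw [← Finset.sum_subset (Finset.subset_univ F), ← Finset.sum_coe_sort F]
    · simp
    · intro i _ hi
      simp [hi]
  refine ⟨fun i => if h : i ∈ F then g ⟨i, h⟩ else 0, ⟨i₀, i₀.2, by simpa using hi₀⟩,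
    fun i hi => by simp [hi], ?_, ?_⟩
  · rw [hsum]
    simpa [Prod.fst_sum] using congrArg Prod.fst hg
  · rw [hsum]
    simpa [Prod.snd_sum] using congrArg Prod.snd hg

/-- The LP relaxation of the knapsack problem with item improvement. -/
def improvementPolytope {n : ℕ} (j : Fin n → ℕ) (w c : Fin n → ℕ → ℝ) (B C : ℝ) :
    Set ((Fin n → ℝ) × ((i : Fin n) → Fin (j i) → ℝ)) :=
  {z | (∀ i, 0 ≤ z.1 i ∧ z.1 i ≤ 1) ∧
    (∀ (i : Fin n) (ℓ : Fin (j i)), 0 ≤ z.2 i ℓ) ∧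
    (∀ (i : Fin n) (ℓ : Fin (j i)), z.2 i ℓ ≤ z.1 i) ∧
    (∀ (i : Fin n) (ℓ ℓ' : Fin (j i)), ℓ ≤ ℓ' → z.2 i ℓ' ≤ z.2 i ℓ) ∧
    (∑ i, w i 0 * z.1 i)
      + (∑ i, ∑ ℓ : Fin (j i), (w i ((ℓ : ℕ) + 1) - w i (ℓ : ℕ)) * z.2 i ℓ) ≤ B ∧
    (∑ i, ∑ ℓ : Fin (j i), (c i ((ℓ : ℕ) + 1) - c i (ℓ : ℕ)) * z.2 i ℓ) ≤ C}

open Filter Topology in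
/-- An extreme point of the LP relaxation has at most two fractional blocks. -/
lemma card_le_two_of_mem_extremePoints_s12 {n : ℕ} {j : Fin n → ℕ} {w c : Fin n → ℕ → ℝ} {B C : ℝ}
    {x : Fin n → ℝ} {y : (i : Fin n) → Fin (j i) → ℝ}
    (hext : (x, y) ∈ (improvementPolytope j w c B C).extremePoints ℝ) (F : Finset (Fin n))
    (hF : ∀ i ∈ F, ¬ ((x i = 0 ∨ x i = 1) ∧ ∀ ℓ : Fin (j i), y i ℓ = 0 ∨ y i ℓ = 1)) :
    F.card ≤ 2 := by
  by_contra! hcard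
  rw [mem_extremePoints] at hext
  obtain ⟨⟨hx, hy0, hyx, hymono, hw, hc⟩, hext⟩ := hext
  have hfrac : ∀ i, ∃ v : ℝ, v ≠ 0 ∧ v ≠ 1 ∧ (i ∈ F → x i = v ∨ ∃ ℓ, y i ℓ = v) := by
    intro i
    by_cases hi : i ∈ F
    · have h := hF i hi
      by_cases hxi : x i = 0 ∨ x i = 1
      · obtain ⟨ℓ, hℓ⟩ : ∃ ℓ : Fin (j i), ¬ (y i ℓ = 0 ∨ y i ℓ = 1) := by
          by_contra! h'
          exact h ⟨hxi, fun ℓ => by tauto⟩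
        exact ⟨y i ℓ, by tauto, by tauto, fun _ => Or.inr ⟨ℓ, rfl⟩⟩
      · exact ⟨x i, by tauto, by tauto, fun _ => Or.inl rfl⟩
    · exact ⟨2, by norm_num, by norm_num, fun h => absurd h hi⟩
  choose v hv0 hv1 hv using hfrac
  obtain ⟨a, ⟨i₀, hi₀, ha⟩, -, hα, hβ⟩ := exists_ne_zero_sum_mul_eq_zero F hcard
    (fun i => w i 0 * (if x i = v i then 1 else 0) +
      ∑ ℓ : Fin (j i), (w i ((ℓ : ℕ) + 1) - w i (ℓ : ℕ)) * (if y i ℓ = v i then 1 else 0))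
    (fun i => ∑ ℓ : Fin (j i), (c i ((ℓ : ℕ) + 1) - c i (ℓ : ℕ)) *
      (if y i ℓ = v i then 1 else 0))
  let z : ℝ → (Fin n → ℝ) × ((i : Fin n) → Fin (j i) → ℝ) := fun t =>
    (fun i => x i + t * (a i * if x i = v i then 1 else 0),
      fun i ℓ => y i ℓ + t * (a i * if y i ℓ = v i then 1 else 0))
  have hz : ∀ᶠ t in 𝓝 (0 : ℝ), z t ∈ improvementPolytope j w c B C := by
    have hnonneg : ∀ (i : Fin n) {u : ℝ}, 0 ≤ u →
        ∀ᶠ t : ℝ in 𝓝 0, 0 ≤ u + t * (a i * if u = v i then 1 else 0) := fun i u hu => by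
      simpa [(hv0 i).symm] using eventually_shift_le_shift (a i) (v i) hu
    have hle_one : ∀ (i : Fin n) {u : ℝ}, u ≤ 1 →
        ∀ᶠ t : ℝ in 𝓝 0, u + t * (a i * if u = v i then 1 else 0) ≤ 1 := fun i u hu => by
      simpa [(hv1 i).symm] using eventually_shift_le_shift (a i) (v i) hu
    have h₁ := eventually_all.2 fun i => (hnonneg i (hx i).1).and (hle_one i (hx i).2)
    have h₂ := eventually_all.2 fun i => eventually_all.2 fun ℓ => hnonneg i (hy0 i ℓ)
    have h₃ := eventually_all.2 fun i => eventually_all.2 fun ℓ =>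
      eventually_shift_le_shift (a i) (v i) (hyx i ℓ)
    have h₄ := eventually_all.2 fun i => eventually_all.2 fun ℓ => eventually_all.2 fun ℓ' =>
      eventually_all.2 fun h : ℓ ≤ ℓ' =>
        eventually_shift_le_shift (a i) (v i) (hymono i ℓ ℓ' h)
    filter_upwards [h₁, h₂, h₃, h₄] with t h₁ h₂ h₃ h₄
    refine ⟨h₁, h₂, h₃, h₄, ?_, ?_⟩
    · refine le_of_eq_of_le (Eq.symm ?_) hw
      rw [← add_zero (_ + _ : ℝ), ← mul_zero t, ← hα]
      simp only [z, mul_add, Finset.mul_sum, Finset.sum_add_distrib]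
      simp only [mul_left_comm]
      ring
    · refine le_of_eq_of_le (Eq.symm ?_) hc
      rw [← add_zero (∑ i, _ : ℝ), ← mul_zero t, ← hβ]
      simp only [z, mul_add, Finset.mul_sum, Finset.sum_add_distrib]
      simp only [mul_left_comm]
  have hz' : ∀ᶠ t in 𝓝 (0 : ℝ), z (-t) ∈ improvementPolytope j w c B C :=
    (continuous_neg.tendsto' (0 : ℝ) 0 neg_zero).eventually hz
  obtain ⟨t, ⟨hzt, hzt'⟩, ht⟩ :=
    (((hz.and hz').filter_mono nhdsWithin_le_nhds).and
      (self_mem_nhdsWithin : ∀ᶠ t in 𝓝[≠] (0 : ℝ), t ∈ ({0}ᶜ : Set ℝ))).exists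
  have ht : t ≠ 0 := ht
  have hseg : (x, y) ∈ openSegment ℝ (z t) (z (-t)) := by
    refine ⟨1 / 2, 1 / 2, by norm_num, by norm_num, by norm_num, ?_⟩
    ext i
    · simp only [z, Prod.fst_add, Prod.smul_fst, Pi.add_apply, Pi.smul_apply, smul_eq_mul]
      ring
    · simp only [z, Prod.snd_add, Prod.smul_snd, Pi.add_apply, Pi.smul_apply, smul_eq_mul]
      ring
  have hzeq : z t = (x, y) := (hext _ hzt _ hzt' hseg).1
  rcases hv i₀ hi₀ with h | ⟨ℓ, h⟩
  · have := congrFun (congrArg Prod.fst hzeq) i₀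
    simp [z, h, ht, ha] at this
  · have := congrFun (congrFun (congrArg Prod.snd hzeq) i₀) ℓ
    simp [z, h, ht, ha] at this

/-- A telescoping sum cut off at level `m`. -/
lemma add_sum_sub_mul_eq_of_threshold (f : ℕ → ℝ) {k m : ℕ} (hm : m ≤ k) (y : Fin k → ℝ)
    (hy : ∀ ℓ, y ℓ = 0 ∨ y ℓ = 1) (hym : ∀ ℓ : Fin k, y ℓ = 1 ↔ (ℓ : ℕ) + 1 ≤ m) :
    f 0 + ∑ ℓ : Fin k, (f ((ℓ : ℕ) + 1) - f ℓ) * y ℓ = f m := by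
  have hy' : ∀ ℓ : Fin k, y ℓ = if (ℓ : ℕ) < m then 1 else 0 := by
    intro ℓ
    split_ifs with h
    · exact (hym ℓ).2 h
    · exact (hy ℓ).resolve_right fun h' => h ((hym ℓ).1 h')
  simp only [hy']
  rw [Fin.sum_univ_eq_sum_range (fun ℓ => (f (ℓ + 1) - f ℓ) * if ℓ < m then 1 else 0) k,
    ← Finset.sum_subset (Finset.range_subset_range.2 hm)]
  · rw [Finset.sum_congr rfl fun ℓ hℓ => by rw [if_pos (Finset.mem_range.1 hℓ), mul_one],
      Finset.sum_range_sub]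
    ring
  · intro ℓ _ hℓ
    rw [if_neg (by simpa using hℓ), mul_zero]

/-- The fractional weight of an item is nonnegative when its final weight is. -/
lemma weight_block_nonneg (f : ℕ → ℝ) {k : ℕ} (hf : 0 ≤ f k)
    (hmono : ∀ ℓ < k, f (ℓ + 1) ≤ f ℓ) {x : ℝ} (hx : 0 ≤ x) {y : Fin k → ℝ}
    (hy : ∀ ℓ, y ℓ ≤ x) :
    0 ≤ f 0 * x + ∑ ℓ : Fin k, (f ((ℓ : ℕ) + 1) - f ℓ) * y ℓ := by
  have hle : ∑ ℓ : Fin k, (f ((ℓ : ℕ) + 1) - f ℓ) * x ≤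
      ∑ ℓ : Fin k, (f ((ℓ : ℕ) + 1) - f ℓ) * y ℓ :=
    Finset.sum_le_sum fun ℓ _ =>
      mul_le_mul_of_nonpos_left (hy ℓ) (sub_nonpos.2 (hmono ℓ ℓ.2))
  rw [← Finset.sum_mul, Fin.sum_univ_eq_sum_range (fun ℓ => f (ℓ + 1) - f ℓ) k,
    Finset.sum_range_sub] at hle
  nlinarith [mul_nonneg hf hx]


/-- Assume `p i ≥ 0` and `w i (j i) ≥ 0` for all `i`, `B ≥ 0`, `C ≥ 0`,
and that every item can be packed alone (level `ℓsolo i`).  Let `(x, y)` be an extreme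
point of the LP relaxation polytope `P_LP` of (iK-dm) with `∑ p i * x i ≥ OPT`.  Let `J`
be the set of integral items with `x i = 1`, packed at levels `ℓJ i` (the top level with
`y`-value `1`, or `0` if none), and let `F` be the set of non-integral items.  Then:
(i) packing the items of `J` at levels `ℓJ` is feasible for (iK-dm); (ii) each `f ∈ F`
packed alone at level `ℓsolo f` is feasible; (iii) `∑_{i∈J} p i + ∑_{f∈F} p f ≥ OPT`;
consequently the best of these at most three solutions has value at least `OPT / 3`. -/
theorem stmt_12 (n : ℕ) (j : Fin n → ℕ)
    (p : Fin n → ℝ) (w c : Fin n → ℕ → ℝ) (B C : ℝ)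
    (hp : ∀ i, 0 ≤ p i) (hwlast : ∀ i, 0 ≤ w i (j i))
    (hB : 0 ≤ B) (hC : 0 ≤ C)
    (hwmono : ∀ (i : Fin n) (ℓ : ℕ), ℓ < j i → w i (ℓ + 1) ≤ w i ℓ)
    (hc0 : ∀ i, c i 0 = 0)
    (hcmono : ∀ (i : Fin n) (ℓ : ℕ), ℓ < j i → c i ℓ ≤ c i (ℓ + 1))
    (ℓsolo : Fin n → ℕ)
    (hsolo : ∀ i, ℓsolo i ≤ j i ∧ w i (ℓsolo i) ≤ B ∧ c i (ℓsolo i) ≤ C)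
    (Feas : Finset (Fin n) → (Fin n → ℕ) → Prop)
    (hFeas : ∀ S ℓ, Feas S ℓ ↔ ((∀ s ∈ S, ℓ s ≤ j s) ∧
      (∑ s ∈ S, w s (ℓ s)) ≤ B ∧ (∑ s ∈ S, c s (ℓ s)) ≤ C))
    (OPT : ℝ)
    (hOPT : IsGreatest {v : ℝ | ∃ S ℓ, Feas S ℓ ∧ v = ∑ s ∈ S, p s} OPT)
    (PLP : Set ((Fin n → ℝ) × ((i : Fin n) → Fin (j i) → ℝ)))
    (hPLP : PLP = {z | (∀ i, 0 ≤ z.1 i ∧ z.1 i ≤ 1) ∧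
      (∀ (i : Fin n) (ℓ : Fin (j i)), 0 ≤ z.2 i ℓ) ∧
      (∀ (i : Fin n) (ℓ : Fin (j i)), z.2 i ℓ ≤ z.1 i) ∧
      (∀ (i : Fin n) (ℓ ℓ' : Fin (j i)), ℓ ≤ ℓ' → z.2 i ℓ' ≤ z.2 i ℓ) ∧
      (∑ i, w i 0 * z.1 i)
        + (∑ i, ∑ ℓ : Fin (j i), (w i ((ℓ : ℕ) + 1) - w i (ℓ : ℕ)) * z.2 i ℓ) ≤ B ∧
      (∑ i, ∑ ℓ : Fin (j i), (c i ((ℓ : ℕ) + 1) - c i (ℓ : ℕ)) * z.2 i ℓ) ≤ C})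
    (x : Fin n → ℝ) (y : (i : Fin n) → Fin (j i) → ℝ)
    (hext : (x, y) ∈ PLP.extremePoints ℝ)
    (hval : OPT ≤ ∑ i, p i * x i)
    (J : Finset (Fin n))
    (hJ : J = Finset.univ.filter (fun i => x i = 1 ∧
      ∀ ℓ : Fin (j i), y i ℓ = 0 ∨ y i ℓ = 1))
    (F : Finset (Fin n))
    (hF : F = Finset.univ.filter (fun i =>
      ¬ ((x i = 0 ∨ x i = 1) ∧ ∀ ℓ : Fin (j i), y i ℓ = 0 ∨ y i ℓ = 1)))
    (ℓJ : Fin n → ℕ)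
    (hℓJ : ∀ i ∈ J, ℓJ i ≤ j i ∧
      ∀ ℓ : Fin (j i), (y i ℓ = 1 ↔ (ℓ : ℕ) + 1 ≤ ℓJ i)) :
    Feas J ℓJ ∧
    (∀ f ∈ F, Feas {f} ℓsolo) ∧
    OPT ≤ (∑ i ∈ J, p i) + (∑ f ∈ F, p f) ∧
    (OPT / 3 ≤ ∑ i ∈ J, p i ∨ ∃ f ∈ F, OPT / 3 ≤ p f) := by
  have hcard : F.card ≤ 2 := by
    subst hPLP
    refine card_le_two_of_mem_extremePoints_s12 (B := B) (C := C) (w := w) (c := c) hext F ?_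
    intro i hi
    simpa only [hF, Finset.mem_filter, Finset.mem_univ, true_and] using hi
  have hmem := hext.1
  rw [hPLP] at hmem
  obtain ⟨hx, hy0, hyx, -, hw, hc⟩ := hmem
  dsimp only at hx hy0 hyx hw hc
  have hJmem : ∀ i ∈ J, x i = 1 ∧ ∀ ℓ : Fin (j i), y i ℓ = 0 ∨ y i ℓ = 1 := by
    intro i hi
    simpa only [hJ, Finset.mem_filter, Finset.mem_univ, true_and] using hi
  have hJfeas : Feas J ℓJ := by
    refine (hFeas _ _).2 ⟨fun s hs => (hℓJ s hs).1, ?_, ?_⟩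
    · rw [← Finset.sum_add_distrib] at hw
      refine le_trans ?_ hw
      refine le_trans (Finset.sum_le_sum fun i hi => ?_)
        (Finset.sum_le_sum_of_subset_of_nonneg (Finset.subset_univ J) fun i _ _ =>
          weight_block_nonneg (w i) (hwlast i) (hwmono i) (hx i).1 (hyx i))
      rw [(hJmem i hi).1, mul_one, add_sum_sub_mul_eq_of_threshold (w i) (hℓJ i hi).1 (y i)
        (hJmem i hi).2 (hℓJ i hi).2]
    · refine le_trans ?_ hc
      refine le_trans (Finset.sum_le_sum fun i hi => ?_)
        (Finset.sum_le_sum_of_subset_of_nonneg (Finset.subset_univ J) fun i _ _ =>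
          Finset.sum_nonneg fun ℓ _ =>
            mul_nonneg (sub_nonneg.2 (hcmono i ℓ ℓ.2)) (hy0 i ℓ))
      rw [← add_sum_sub_mul_eq_of_threshold (c i) (hℓJ i hi).1 (y i)
        (hJmem i hi).2 (hℓJ i hi).2, hc0, zero_add]
  have hbound : OPT ≤ (∑ i ∈ J, p i) + ∑ f ∈ F, p f := by
    have hdisj : Disjoint J F := by
      rw [hJ, hF, Finset.disjoint_filter]
      exact fun i _ h h' => h' ⟨Or.inr h.1, h.2⟩
    rw [← Finset.sum_union hdisj]
    refine hval.trans ?_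
    rw [← Finset.sum_subset (Finset.subset_univ (J ∪ F))]
    · exact Finset.sum_le_sum fun i _ => mul_le_of_le_one_right (hp i) (hx i).2
    · intro i _ hi
      have hx0 : x i = 0 := by
        simp only [hJ, hF, Finset.mem_union, Finset.mem_filter, Finset.mem_univ, true_and] at hi
        tauto
      rw [hx0, mul_zero]
  refine ⟨hJfeas, fun f _ => (hFeas _ _).2 (by simpa using hsolo f), hbound, ?_⟩
  by_contra! h
  obtain ⟨hJlt, hFlt⟩ := h
  have hJnonneg : 0 ≤ ∑ i ∈ J, p i := Finset.sum_nonneg fun i _ => hp i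
  have hFle : ∑ f ∈ F, p f ≤ F.card * (OPT / 3) := by
    simpa using Finset.sum_le_card_nsmul F p (OPT / 3) fun f hf => (hFlt f hf).le
  have hcard' : (F.card : ℝ) ≤ 2 := by exact_mod_cast hcard
  nlinarith
end

section
/- Let k ∈ ℕ and let Q = { (x, x̂) ∈ ℝ^n × ℝ^n : 0 ≤ x_i ≤ 1 and 0 ≤ x̂_i ≤ 1 for all i, Σ_{i=1}^n w_i x_i + Σ_{i=1}^n ŵ_i x̂_i ≤ B, Σ_{i=1}^n x̂_i ≤ k }. Then every extreme point of Q has at most two coordinates lying strictly between 0 and 1; moreover, if an extreme point of Q has exactly two coordinates in (0,1), then both are x̂-coordinates, say x̂_i and x̂_j with i ≠ j, and x̂_i + x̂_j = 1. -/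
open Filter Topology

/-- A direction along which every small move stays in `Q` vanishes at an extreme point. -/
theorem eq_zero_of_eventually_mem_of_extremePoint {E : Type*} [AddCommGroup E] [Module ℝ E]
    {Q : Set E} {z d : E} (hz : z ∈ Q.extremePoints ℝ)
    (h : ∀ᶠ ε : ℝ in 𝓝 0, z + ε • d ∈ Q) : d = 0 := by
  have hneg : ∀ᶠ ε : ℝ in 𝓝 0, z + (-ε) • d ∈ Q := by
    have ht : Tendsto (fun ε : ℝ => -ε) (𝓝 0) (𝓝 0) := by
      simpa using (continuous_neg.tendsto (0 : ℝ))
    exact ht.eventually h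
  obtain ⟨ε, ⟨h1, h2⟩, hε⟩ :=
    (((h.and hneg).filter_mono nhdsWithin_le_nhds).and
      (self_mem_nhdsWithin : Set.Ioi (0 : ℝ) ∈ 𝓝[>] 0)).exists
  have hε' : ε ≠ 0 := ne_of_gt hε
  have hseg : z ∈ openSegment ℝ (z + ε • d) (z + (-ε) • d) :=
    ⟨1 / 2, 1 / 2, by norm_num, by norm_num, by norm_num, by module⟩
  have key := (mem_extremePoints_iff_left.1 hz).2 _ h1 _ h2 hseg
  have : ε • d = 0 := by simpa using key
  exact (smul_eq_zero.1 this).resolve_left hε'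

/-- If a linear map kills no nonzero pair of vectors supported on `S` and `T`, then
its codomain has dimension at least `|S| + |T|`. -/
theorem ncard_add_ncard_le_finrank {n : ℕ} {F : Type*} [AddCommGroup F] [Module ℝ F]
    [FiniteDimensional ℝ F] (φ : ((Fin n → ℝ) × (Fin n → ℝ)) →ₗ[ℝ] F) (S T : Set (Fin n))
    (h : ∀ d : (Fin n → ℝ) × (Fin n → ℝ), (∀ i ∉ S, d.1 i = 0) → (∀ i ∉ T, d.2 i = 0) →
      φ d = 0 → d = 0) :
    S.ncard + T.ncard ≤ Module.finrank ℝ F := by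
  classical
  let e : ((S → ℝ) × (T → ℝ)) →ₗ[ℝ] ((Fin n → ℝ) × (Fin n → ℝ)) :=
    (Function.ExtendByZero.linearMap ℝ (Subtype.val : S → Fin n)).prodMap
      (Function.ExtendByZero.linearMap ℝ (Subtype.val : T → Fin n))
  have ext_out (U : Set (Fin n)) (f : U → ℝ) (i : Fin n) (hi : i ∉ U) :
      Function.extend Subtype.val f 0 i = 0 := by
    rw [Function.extend_apply']
    · rfl
    · rintro ⟨a, rfl⟩
      exact hi a.2
  have ext_zero (U : Set (Fin n)) (f : U → ℝ)
      (hf : Function.extend Subtype.val f (0 : Fin n → ℝ) = 0) : f = 0 := by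
    funext i
    simpa [Subtype.val_injective.extend_apply] using congrFun hf i
  have hinj : Function.Injective (φ ∘ₗ e) := by
    rw [← LinearMap.ker_eq_bot, LinearMap.ker_eq_bot']
    rintro ⟨f, g⟩ hfg
    have h0 := h (e (f, g)) (fun i hi => ext_out S f i hi) (fun i hi => ext_out T g i hi) hfg
    exact Prod.ext (ext_zero S f (congrArg Prod.fst h0)) (ext_zero T g (congrArg Prod.snd h0))
  have := LinearMap.finrank_le_finrank_of_injective hinj
  simpa [Module.finrank_prod, Module.finrank_fintype_fun_eq_card, ← Nat.card_eq_fintype_card,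
    Nat.card_coe_set_eq] using this

/-- A coordinate in `[0, 1]` stays there under small moves, if it moves only when fractional. -/
theorem eventually_add_mul_mem_unit {a d : ℝ} (ha : 0 ≤ a ∧ a ≤ 1)
    (hd : ¬(0 < a ∧ a < 1) → d = 0) :
    ∀ᶠ ε : ℝ in 𝓝 0, 0 ≤ a + ε * d ∧ a + ε * d ≤ 1 := by
  by_cases h : 0 < a ∧ a < 1
  · have hc : Tendsto (fun ε : ℝ => a + ε * d) (𝓝 0) (𝓝 a) := by
      have : Continuous fun ε : ℝ => a + ε * d := by fun_prop
      simpa using this.tendsto 0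
    filter_upwards [hc.eventually (lt_mem_nhds h.1), hc.eventually (gt_mem_nhds h.2)]
      with ε h1 h2 using ⟨h1.le, h2.le⟩
  · simp [hd h, ha]

/-- If all fractional coordinates of a vector in `[0, 1]ⁿ` lie in `T`, then the coordinates
outside `T` have an integral sum. -/
theorem exists_int_sum_compl {n : ℕ} {x : Fin n → ℝ} (hx : ∀ i, 0 ≤ x i ∧ x i ≤ 1)
    (T : Finset (Fin n)) (hT : ∀ i, 0 < x i ∧ x i < 1 → i ∈ T) :
    ∃ m : ℤ, ∑ i ∈ Tᶜ, x i = m := by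
  have h : ∀ i ∈ Tᶜ, x i = ((⌊x i⌋ : ℤ) : ℝ) := by
    intro i hi
    have hi' : ¬(0 < x i ∧ x i < 1) := fun h => (Finset.mem_compl.1 hi) (hT i h)
    rcases (hx i).1.eq_or_lt with h0 | h0
    · simp [← h0]
    · have : x i = 1 := le_antisymm (hx i).2 (not_lt.1 fun h1 => hi' ⟨h0, h1⟩)
      simp [this]
  exact ⟨∑ i ∈ Tᶜ, ⌊x i⌋, by rw [Int.cast_sum]; exact Finset.sum_congr rfl h⟩

/-- Let `k ∈ ℕ` and let `Q` be the feasible polytope of the LP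
relaxation of CKP′.  Then every extreme point of `Q` has at most two coordinates lying
strictly between `0` and `1`; moreover, if an extreme point has exactly two coordinates
in `(0,1)`, then both are `x̂`-coordinates, say `x̂ i` and `x̂ j` with `i ≠ j`, and
`x̂ i + x̂ j = 1`. -/
theorem stmt_13 (n : ℕ) (hn : 1 ≤ n)
    (w what : Fin n → ℝ) (B : ℝ) (k : ℕ)
    (Q : Set ((Fin n → ℝ) × (Fin n → ℝ)))
    (hQ : Q = {z | (∀ i, 0 ≤ z.1 i ∧ z.1 i ≤ 1) ∧ (∀ i, 0 ≤ z.2 i ∧ z.2 i ≤ 1) ∧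
      (∑ i, w i * z.1 i) + (∑ i, what i * z.2 i) ≤ B ∧
      (∑ i, z.2 i) ≤ (k : ℝ)})
    (z : (Fin n → ℝ) × (Fin n → ℝ)) (hz : z ∈ Q.extremePoints ℝ) :
    ({i : Fin n | 0 < z.1 i ∧ z.1 i < 1}.ncard
        + {i : Fin n | 0 < z.2 i ∧ z.2 i < 1}.ncard ≤ 2) ∧
    ({i : Fin n | 0 < z.1 i ∧ z.1 i < 1}.ncard
        + {i : Fin n | 0 < z.2 i ∧ z.2 i < 1}.ncard = 2 →
      {i : Fin n | 0 < z.1 i ∧ z.1 i < 1} = ∅ ∧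
      ∃ i j : Fin n, i ≠ j ∧
        {t : Fin n | 0 < z.2 t ∧ z.2 t < 1} = {i, j} ∧
        z.2 i + z.2 j = 1) := by
  classical
  set S : Set (Fin n) := {i | 0 < z.1 i ∧ z.1 i < 1} with hS
  set T : Set (Fin n) := {i | 0 < z.2 i ∧ z.2 i < 1} with hT
  have hzQ : z ∈ Q := hz.1
  rw [hQ] at hzQ
  obtain ⟨hx, hy, hB, hk⟩ := hzQ
  let α : ((Fin n → ℝ) × (Fin n → ℝ)) →ₗ[ℝ] ℝ :=
    { toFun := fun d => (∑ i, w i * d.1 i) + ∑ i, what i * d.2 i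
      map_add' := fun a b => by
        simp only [Prod.fst_add, Prod.snd_add, Pi.add_apply, mul_add, Finset.sum_add_distrib]
        ring
      map_smul' := fun c a => by
        simp only [Prod.smul_fst, Prod.smul_snd, Pi.smul_apply, smul_eq_mul, mul_left_comm _ c,
          ← Finset.mul_sum, RingHom.id_apply]
        ring }
  let β : ((Fin n → ℝ) × (Fin n → ℝ)) →ₗ[ℝ] ℝ :=
    { toFun := fun d => ∑ i, d.2 i
      map_add' := fun a b => by simp [Finset.sum_add_distrib]
      map_smul' := fun c a => by simp [Finset.mul_sum] }
  have hdir : ∀ d : (Fin n → ℝ) × (Fin n → ℝ), (∀ i ∉ S, d.1 i = 0) → (∀ i ∉ T, d.2 i = 0) →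
      α d = 0 → (β d = 0 ∨ β z < k) → d = 0 := by
    intro d hd1 hd2 hα hβ
    apply eq_zero_of_eventually_mem_of_extremePoint hz
    have e1 : ∀ᶠ ε : ℝ in 𝓝 0, ∀ i, 0 ≤ z.1 i + ε * d.1 i ∧ z.1 i + ε * d.1 i ≤ 1 :=
      eventually_all.2 fun i => eventually_add_mul_mem_unit (hx i) (hd1 i)
    have e2 : ∀ᶠ ε : ℝ in 𝓝 0, ∀ i, 0 ≤ z.2 i + ε * d.2 i ∧ z.2 i + ε * d.2 i ≤ 1 :=
      eventually_all.2 fun i => eventually_add_mul_mem_unit (hy i) (hd2 i)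
    have e3 : ∀ᶠ ε : ℝ in 𝓝 0, β z + ε * β d ≤ k := by
      rcases hβ with h | h
      · exact Eventually.of_forall fun ε => by rw [h, mul_zero, add_zero]; exact hk
      · have hc : Tendsto (fun ε : ℝ => β z + ε * β d) (𝓝 0) (𝓝 (β z)) := by
          have : Continuous fun ε : ℝ => β z + ε * β d := by fun_prop
          simpa using this.tendsto 0
        filter_upwards [hc.eventually (gt_mem_nhds h)] with ε h1 using h1.le
    filter_upwards [e1, e2, e3] with ε h1 h2 h3
    rw [hQ]
    refine ⟨h1, h2, ?_, ?_⟩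
    · change α (z + ε • d) ≤ B
      rw [map_add, map_smul, hα, smul_zero, add_zero]
      exact hB
    · change β (z + ε • d) ≤ k
      rw [map_add, map_smul]
      exact h3
  have hle : S.ncard + T.ncard ≤ 2 := by
    have := ncard_add_ncard_le_finrank (α.prod β) S T fun d h1 h2 h3 =>
      hdir d h1 h2 (congrArg Prod.fst h3) (Or.inl (congrArg Prod.snd h3))
    simpa [Module.finrank_prod] using this
  refine ⟨hle, fun hcard => ?_⟩
  have htight : β z = k := by
    refine le_antisymm hk (not_lt.1 fun hlt => ?_)
    have := ncard_add_ncard_le_finrank α S T fun d h1 h2 h3 => hdir d h1 h2 h3 (Or.inr hlt)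
    rw [Module.finrank_self] at this
    omega
  have hT0 : T.ncard ≠ 0 := by
    intro h0
    have hTe : T = ∅ := (Set.ncard_eq_zero (Set.toFinite T)).1 h0
    have := ncard_add_ncard_le_finrank α S T fun d h1 h2 h3 =>
      hdir d h1 h2 h3 (Or.inl (show ∑ i, d.2 i = 0 from
        Finset.sum_eq_zero fun i _ => h2 i (by simp [hTe])))
    rw [Module.finrank_self] at this
    omega
  obtain ⟨m, hm⟩ := exists_int_sum_compl hy T.toFinset fun i hi => by
    simpa [hT] using hi
  have hsum : ∑ i ∈ T.toFinset, z.2 i = (((k : ℤ) - m : ℤ) : ℝ) := by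
    have h1 := Finset.sum_add_sum_compl T.toFinset z.2
    have h2 : ∑ i, z.2 i = k := htight
    push_cast
    linarith
  have hT1 : T.ncard ≠ 1 := by
    intro h1
    obtain ⟨i, hi⟩ := Set.ncard_eq_one.1 h1
    have hiT : i ∈ T := by simp [hi]
    have hf : T.toFinset = {i} := by ext; simp [hi]
    rw [hf, Finset.sum_singleton] at hsum
    have hlo : 0 < z.2 i := hiT.1
    have hhi : z.2 i < 1 := hiT.2
    rw [hsum] at hlo hhi
    have hlo' : 0 < (k : ℤ) - m := by exact_mod_cast hlo
    have hhi' : (k : ℤ) - m < 1 := by exact_mod_cast hhi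
    omega
  refine ⟨(Set.ncard_eq_zero (Set.toFinite S)).1 (by omega), ?_⟩
  obtain ⟨i, j, hij, hTij⟩ := Set.ncard_eq_two.1 (show T.ncard = 2 by omega)
  refine ⟨i, j, hij, hTij, ?_⟩
  have hiT : i ∈ T := by simp [hTij]
  have hjT : j ∈ T := by simp [hTij]
  have hf : T.toFinset = {i, j} := by ext; simp [hTij]
  rw [hf, Finset.sum_pair hij] at hsum
  have hlo : 0 < z.2 i + z.2 j := add_pos hiT.1 hjT.1
  have hhi : z.2 i + z.2 j < 2 := by linarith [hiT.2, hjT.2]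
  rw [hsum] at hlo hhi ⊢
  have hlo' : 0 < (k : ℤ) - m := by exact_mod_cast hlo
  have hhi' : (k : ℤ) - m < 2 := by exact_mod_cast hhi
  have : (k : ℤ) - m = 1 := by omega
  rw [this, Int.cast_one]
end

section
/- Consider (iK-ds) with unit improvement costs c_i = 1 and improvement budget C = k ∈ ℕ, k ≥ 1, and assume p_i ≥ 0, 0 ≤ ŵ_i ≤ w_i and ŵ_i ≤ B for all i. Let (x, x̂) be an extreme point of the polytope Q = { (x, x̂) ∈ [0,1]^{2n} : Σ_i w_i x_i + Σ_i ŵ_i x̂_i ≤ B, Σ_i x̂_i ≤ k } with Σ_i p_i (x_i + x̂_i) ≥ iK-ds*, and let J_I = {i : x_i = 1}, Ĵ_I = {i : x̂_i = 1}, and J_F the set of coordinates of (x,x̂) in (0,1). Then: if J_F = ∅, the solutions (J_I unimproved) and (Ĵ_I improved) are feasible for (iK-ds) and the larger of their values is at least iK-ds*/2; if J_F consists of one fractional coordinate belonging to item i, the solutions ({i} improved), (J_I unimproved) and (Ĵ_I improved) are feasible and the largest of their values is at least iK-ds*/3; and if J_F consists of two fractional coordinates, belonging to items i and j with ŵ_i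 ≥ ŵ_j, the solutions ({i} improved), (J_I unimproved) and (Ĵ_I ∪ {j} improved) are feasible and the largest of their values is at least iK-ds*/3. -/
open Filter Topology in
/-- Small moves in both directions along `d` keep a point of the unit cube inside the cube,
as long as `d` vanishes on the integral coordinates. -/
theorem eventually_add_smul_mem_unitCube {ι : Type*} [Finite ι] {y d : ι → ℝ}
    (hy : ∀ t, 0 ≤ y t ∧ y t ≤ 1) (hd : ∀ t, d t ≠ 0 → 0 < y t ∧ y t < 1) :
    ∀ᶠ ε in 𝓝 (0 : ℝ), ∀ t, 0 ≤ y t + ε * d t ∧ y t + ε * d t ≤ 1 := by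
  refine eventually_all.2 fun t => ?_
  by_cases h : d t = 0
  · simp [h, hy t]
  · have hc : Tendsto (fun ε : ℝ => y t + ε * d t) (𝓝 0) (𝓝 (y t)) := by
      have : Continuous (fun ε : ℝ => y t + ε * d t) := by fun_prop
      simpa using this.tendsto 0
    filter_upwards [hc.eventually_const_lt (hd t h).1, hc.eventually_lt_const (hd t h).2]
      with ε h₀ h₁ using ⟨h₀.le, h₁.le⟩

open Filter Topology in
/-- A direction along which a point can be moved a little both ways inside a set is zero if
the point is extreme. -/
theorem eq_zero_of_mem_extremePoints_of_eventually {E : Type*} [AddCommGroup E] [Module ℝ E]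
    {s : Set E} {z d : E} (hz : z ∈ s.extremePoints ℝ)
    (h : ∀ᶠ ε in 𝓝 (0 : ℝ), z + ε • d ∈ s) : d = 0 := by
  obtain ⟨δ, hδ, hs⟩ := Metric.eventually_nhds_iff.1 h
  have h₁ : z + (δ / 2) • d ∈ s := hs (by simp [abs_of_pos hδ]; linarith)
  have h₂ : z + (-(δ / 2)) • d ∈ s := hs (by simp [abs_of_pos hδ]; linarith)
  have hmem : z ∈ openSegment ℝ (z + (δ / 2) • d) (z + (-(δ / 2)) • d) :=
    ⟨1 / 2, 1 / 2, by norm_num, by norm_num, by norm_num, by module⟩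
  have := hz.2 h₁ h₂ hmem
  have h₀ : (δ / 2) • d = 0 := by simpa using this
  exact (smul_eq_zero.1 h₀).resolve_left (by positivity)

/-- A nonzero solution of a homogeneous linear equation in two unknowns. -/
theorem exists_ne_zero_mul_add_mul_eq_zero (a b : ℝ) :
    ∃ s t : ℝ, (s ≠ 0 ∨ t ≠ 0) ∧ a * s + b * t = 0 := by
  by_cases h : a = 0
  · exact ⟨1, 0, by simp, by simp [h]⟩
  · exact ⟨-b, a, Or.inr h, by ring⟩

/-- Splitting a weighted sum into the coordinates equal to `1` and a set containing all
fractional ones. -/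
theorem sum_mul_eq_sum_filter_add_sum {ι : Type*} [Fintype ι] {y : ι → ℝ} (f : ι → ℝ)
    (S : Finset ι) (h₀ : ∀ t ∉ S, y t = 0 ∨ y t = 1) (h₁ : ∀ t ∈ S, y t ≠ 1) :
    ∑ t, f t * y t = ∑ t with y t = 1, f t + ∑ t ∈ S, f t * y t := by
  classical
  have hS : ∑ t ∈ S, f t * y t = ∑ t, if t ∈ S then f t * y t else 0 := by simp
  rw [hS, Finset.sum_filter, ← Finset.sum_add_distrib]
  refine Finset.sum_congr rfl fun t _ => ?_
  by_cases ht : t ∈ S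
  · simp [ht, h₁ t ht]
  · rcases h₀ t ht with h | h <;> simp [ht, h]

theorem sum_filter_eq_one_le_sum_mul {ι : Type*} [Fintype ι] {y f : ι → ℝ}
    (hf : ∀ t, 0 ≤ f t) (hy : ∀ t, 0 ≤ y t) :
    ∑ t with y t = 1, f t ≤ ∑ t, f t * y t := by
  rw [Finset.sum_filter]
  refine Finset.sum_le_sum fun t _ => ?_
  split_ifs with h
  · simp [h]
  · exact mul_nonneg (hf t) (hy t)

/-- The relaxation polytope: `x` and `xhat` in the unit cube, subject to a knapsack and a
cardinality constraint. -/
def relaxationPolytope {n : ℕ} (w what : Fin n → ℝ) (B : ℝ) (k : ℕ) :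
    Set ((Fin n → ℝ) × (Fin n → ℝ)) :=
  {z | (∀ i, 0 ≤ z.1 i ∧ z.1 i ≤ 1) ∧ (∀ i, 0 ≤ z.2 i ∧ z.2 i ≤ 1) ∧
    (∑ i, w i * z.1 i) + (∑ i, what i * z.2 i) ≤ B ∧ (∑ i, z.2 i) ≤ (k : ℝ)}

section Polytope

variable {n : ℕ} {w what : Fin n → ℝ} {B : ℝ} {k : ℕ} {x xhat : Fin n → ℝ}

open Filter Topology in
theorem direction_eq_zero_of_mem_extremePoints
    (hext : (x, xhat) ∈ (relaxationPolytope w what B k).extremePoints ℝ) {u v : Fin n → ℝ}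
    (hu : ∀ t, u t ≠ 0 → 0 < x t ∧ x t < 1) (hv : ∀ t, v t ≠ 0 → 0 < xhat t ∧ xhat t < 1)
    (hbudget : ∑ t, w t * u t + ∑ t, what t * v t = 0)
    (hcard : ∑ t, v t = 0 ∨ ∑ t, xhat t < k) : u = 0 ∧ v = 0 := by
  obtain ⟨hx, hxhat, hB, hk⟩ := hext.1
  dsimp only at hx hxhat hB hk
  suffices h : ((u, v) : (Fin n → ℝ) × (Fin n → ℝ)) = 0 by simpa using h
  refine eq_zero_of_mem_extremePoints_of_eventually hext ?_
  have hcard' : ∀ᶠ ε in 𝓝 (0 : ℝ), ∑ t, xhat t + ε * ∑ t, v t ≤ k := by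
    rcases hcard with h | h
    · simp [h, hk]
    · have hc : Tendsto (fun ε : ℝ => ∑ t, xhat t + ε * ∑ t, v t) (𝓝 0) (𝓝 (∑ t, xhat t)) := by
        have : Continuous (fun ε : ℝ => ∑ t, xhat t + ε * ∑ t, v t) := by fun_prop
        simpa using this.tendsto 0
      exact (hc.eventually_lt_const h).mono fun _ => le_of_lt
  filter_upwards [eventually_add_smul_mem_unitCube hx hu,
    eventually_add_smul_mem_unitCube hxhat hv, hcard'] with ε h₁ h₂ h₃
  refine ⟨h₁, h₂, ?_, ?_⟩
  · have : (∑ t, w t * (x t + ε * u t)) + ∑ t, what t * (xhat t + ε * v t)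
        = (∑ t, w t * x t + ∑ t, what t * xhat t)
          + ε * (∑ t, w t * u t + ∑ t, what t * v t) := by
      simp only [mul_add, Finset.sum_add_distrib, Finset.mul_sum, mul_left_comm]
      ring
    simpa [this, hbudget] using hB
  · simpa [Finset.sum_add_distrib, Finset.mul_sum] using h₃

theorem false_of_two_fractional_unimproved
    (hext : (x, xhat) ∈ (relaxationPolytope w what B k).extremePoints ℝ) {i j : Fin n}
    (hij : i ≠ j) (hi : 0 < x i ∧ x i < 1) (hj : 0 < x j ∧ x j < 1) : False := by
  obtain ⟨s, t, hst, h⟩ := exists_ne_zero_mul_add_mul_eq_zero (w i) (w j)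
  have h₀ := (direction_eq_zero_of_mem_extremePoints hext (u := Pi.single i s + Pi.single j t)
    (v := 0) (fun a ha => ?_) (by simp) (by simpa [mul_add, Finset.sum_add_distrib,
      Pi.single_apply] using h) (by simp)).1
  · have h₁ := congrFun h₀ i
    have h₂ := congrFun h₀ j
    simp [hij, hij.symm] at h₁ h₂
    tauto
  · by_cases hai : a = i
    · exact hai ▸ hi
    by_cases haj : a = j
    · exact haj ▸ hj
    simp [hai, haj] at ha

theorem false_of_fractional_unimproved_of_fractional_improved
    (hext : (x, xhat) ∈ (relaxationPolytope w what B k).extremePoints ℝ) {i j : Fin n}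
    (hi : 0 < x i ∧ x i < 1) (hj : 0 < xhat j ∧ xhat j < 1)
    (hslack : ∑ t, xhat t < k) : False := by
  obtain ⟨s, t, hst, h⟩ := exists_ne_zero_mul_add_mul_eq_zero (w i) (what j)
  have h₀ := direction_eq_zero_of_mem_extremePoints hext (u := Pi.single i s)
    (v := Pi.single j t) (fun a ha => ?_) (fun a ha => ?_)
    (by simpa [Pi.single_apply] using h) (Or.inr hslack)
  · simp at h₀
    tauto
  · by_cases hai : a = i
    · exact hai ▸ hi
    simp [hai] at ha
  · by_cases haj : a = j
    · exact haj ▸ hj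
    simp [haj] at ha

theorem sum_improved_eq_of_two_fractional_improved
    (hext : (x, xhat) ∈ (relaxationPolytope w what B k).extremePoints ℝ) {i j : Fin n}
    (hij : i ≠ j) (hi : 0 < xhat i ∧ xhat i < 1) (hj : 0 < xhat j ∧ xhat j < 1) :
    ∑ t, xhat t = k := by
  by_contra hne
  have hslack : ∑ t, xhat t < k := lt_of_le_of_ne hext.1.2.2.2 hne
  obtain ⟨s, t, hst, h⟩ := exists_ne_zero_mul_add_mul_eq_zero (what i) (what j)
  have h₀ := (direction_eq_zero_of_mem_extremePoints hext (u := 0)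
    (v := Pi.single i s + Pi.single j t) (by simp) (fun a ha => ?_)
    (by simpa [mul_add, Finset.sum_add_distrib, Pi.single_apply] using h) (Or.inr hslack)).2
  · have h₁ := congrFun h₀ i
    have h₂ := congrFun h₀ j
    simp [hij, hij.symm] at h₁ h₂
    tauto
  · by_cases hai : a = i
    · exact hai ▸ hi
    by_cases haj : a = j
    · exact haj ▸ hj
    simp [hai, haj] at ha

/-- If the only fractional improved coordinate is `b`, the cardinality constraint is slack. -/
theorem sum_improved_lt_of_one_fractional (hk : ∑ t, xhat t ≤ k) {b : Fin n}
    (hb : 0 < xhat b ∧ xhat b < 1) (h : ∀ t, t ≠ b → xhat t = 0 ∨ xhat t = 1) :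
    ∑ t, xhat t < k := by
  have hsum := sum_mul_eq_sum_filter_add_sum (y := xhat) (fun _ => 1) {b}
    (by simpa using h) (by simpa using hb.2.ne)
  simp only [one_mul, Finset.sum_singleton, Finset.sum_const, nsmul_eq_mul, mul_one] at hsum
  refine lt_of_le_of_ne hk fun heq => ?_
  rw [heq] at hsum
  have h₁ : (Finset.univ.filter fun t => xhat t = 1).card < k := by
    exact_mod_cast (by linarith : ((Finset.univ.filter fun t => xhat t = 1).card : ℝ) < k)
  have h₂ : k < (Finset.univ.filter fun t => xhat t = 1).card + 1 := by
    exact_mod_cast (by linarith :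
      (k : ℝ) < ((Finset.univ.filter fun t => xhat t = 1).card : ℝ) + 1)
  omega

/-- At an extreme point whose only two fractional coordinates belong to distinct items, both
are improved coordinates, they sum to `1`, and all unimproved coordinates are integral. -/
theorem two_fractional_structure
    (hext : (x, xhat) ∈ (relaxationPolytope w what B k).extremePoints ℝ) {i j : Fin n}
    (hij : i ≠ j)
    (hi : ¬ ((x i = 0 ∨ x i = 1) ∧ (xhat i = 0 ∨ xhat i = 1)))
    (hj : ¬ ((x j = 0 ∨ x j = 1) ∧ (xhat j = 0 ∨ xhat j = 1)))
    (hrest : ∀ t, t ≠ i → t ≠ j → (x t = 0 ∨ x t = 1) ∧ (xhat t = 0 ∨ xhat t = 1))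
    (hcard : {t : Fin n | 0 < x t ∧ x t < 1}.ncard
      + {t : Fin n | 0 < xhat t ∧ xhat t < 1}.ncard = 2) :
    (∀ t, x t = 0 ∨ x t = 1) ∧ (0 < xhat i ∧ xhat i < 1) ∧ (0 < xhat j ∧ xhat j < 1) ∧
      ∑ t, xhat t = k := by
  obtain ⟨hx, hxhat, -, hk⟩ := hext.1
  dsimp only at hx hxhat hk
  have frac : ∀ {a : ℝ}, 0 ≤ a ∧ a ≤ 1 → ¬ (a = 0 ∨ a = 1) → 0 < a ∧ a < 1 := by
    intro a ha hne
    push Not at hne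
    exact ⟨lt_of_le_of_ne ha.1 (Ne.symm hne.1), lt_of_le_of_ne ha.2 hne.2⟩
  have pair : ∀ {s : Set (Fin n)} {a b : Fin n}, a ≠ b → a ∈ s → b ∈ s → 2 ≤ s.ncard := by
    intro s a b hab ha hb
    rw [← Set.ncard_pair hab]
    exact Set.ncard_le_ncard (by grind) (Set.toFinite s)
  have mixed : ∀ a b : Fin n, a ≠ b →
      (∀ t, t ≠ a → t ≠ b → xhat t = 0 ∨ xhat t = 1) →
      (0 < x a ∧ x a < 1) → (0 < xhat b ∧ xhat b < 1) → False := by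
    intro a b hab hr ha hb
    refine false_of_fractional_unimproved_of_fractional_improved hext ha hb
      (sum_improved_lt_of_one_fractional hk hb fun t htb => ?_)
    by_cases hta : t = a
    · subst hta
      by_contra hne
      have h₁ := pair (s := {t : Fin n | 0 < xhat t ∧ xhat t < 1}) hab (frac (hxhat t) hne) hb
      have h₂ : 0 < {t : Fin n | 0 < x t ∧ x t < 1}.ncard :=
        (Set.ncard_pos (Set.toFinite _)).2 ⟨t, ha⟩
      omega
    · exact hr t hta htb
  have hi' : (0 < x i ∧ x i < 1) ∨ (0 < xhat i ∧ xhat i < 1) :=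
    (not_and_or.1 hi).imp (frac (hx i)) (frac (hxhat i))
  have hj' : (0 < x j ∧ x j < 1) ∨ (0 < xhat j ∧ xhat j < 1) :=
    (not_and_or.1 hj).imp (frac (hx j)) (frac (hxhat j))
  rcases hi' with hi' | hi' <;> rcases hj' with hj' | hj'
  · exact (false_of_two_fractional_unimproved hext hij hi' hj').elim
  · exact (mixed i j hij (fun t h₁ h₂ => (hrest t h₁ h₂).2) hi' hj').elim
  · exact (mixed j i hij.symm (fun t h₁ h₂ => (hrest t h₂ h₁).2) hj' hi').elim
  · refine ⟨fun t => ?_, hi', hj', sum_improved_eq_of_two_fractional_improved hext hij hi' hj'⟩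
    by_contra hne
    have h₁ := pair (s := {t : Fin n | 0 < xhat t ∧ xhat t < 1}) hij hi' hj'
    have h₂ : 0 < {t : Fin n | 0 < x t ∧ x t < 1}.ncard :=
      (Set.ncard_pos (Set.toFinite _)).2 ⟨t, frac (hx t) hne⟩
    omega

end Polytope


/-- Consider (iK-ds) with unit improvement costs and improvement budget
`C = k ∈ ℕ`, `k ≥ 1`; assume `p i ≥ 0`, `0 ≤ ŵ i ≤ w i` and `ŵ i ≤ B` for all `i`.  A
feasible solution is a pair of disjoint sets `(A, Â)` (items packed unimproved, resp.
improved) with `∑_{A} w + ∑_{Â} ŵ ≤ B` and `|Â| ≤ k`; its value is `∑_{A∪Â} p`, and `OPT`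
(= iK-ds*) is the optimal value.  Let `(x, x̂)` be an extreme point of the CKP′ polytope
`Q` with `∑ p i (x i + x̂ i) ≥ OPT`, and let `JI = {i : x i = 1}`, `JIhat = {i : x̂ i = 1}`.
Then: if there is no fractional coordinate, `(JI unimproved)` and `(JIhat improved)` are
feasible and the larger value is `≥ OPT/2`; if there is exactly one fractional coordinate,
belonging to item `i`, then `({i} improved)`, `(JI unimproved)`, `(JIhat improved)` are
feasible and the largest value is `≥ OPT/3`; if there are exactly two fractional
coordinates, belonging to items `i ≠ j` with `ŵ i ≥ ŵ j`, then `({i} improved)`,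
`(JI unimproved)`, `(JIhat ∪ {j} improved)` are feasible and the largest value is
`≥ OPT/3`. -/
theorem stmt_14 (n : ℕ) (hn : 1 ≤ n)
    (p w what : Fin n → ℝ) (B : ℝ) (k : ℕ) (hk : 1 ≤ k)
    (hp : ∀ i, 0 ≤ p i) (hw : ∀ i, 0 ≤ what i ∧ what i ≤ w i)
    (hwB : ∀ i, what i ≤ B) (hB : 0 ≤ B)
    (Feas : Finset (Fin n) → Finset (Fin n) → Prop)
    (hFeas : ∀ A Ahat, Feas A Ahat ↔ (Disjoint A Ahat ∧
      (∑ i ∈ A, w i) + (∑ i ∈ Ahat, what i) ≤ B ∧ Ahat.card ≤ k))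
    (OPT : ℝ)
    (hOPT : IsGreatest {v : ℝ | ∃ A Ahat, Feas A Ahat ∧
      v = (∑ i ∈ A, p i) + ∑ i ∈ Ahat, p i} OPT)
    (Q : Set ((Fin n → ℝ) × (Fin n → ℝ)))
    (hQ : Q = {z | (∀ i, 0 ≤ z.1 i ∧ z.1 i ≤ 1) ∧ (∀ i, 0 ≤ z.2 i ∧ z.2 i ≤ 1) ∧
      (∑ i, w i * z.1 i) + (∑ i, what i * z.2 i) ≤ B ∧
      (∑ i, z.2 i) ≤ (k : ℝ)})
    (x xhat : Fin n → ℝ) (hext : (x, xhat) ∈ Q.extremePoints ℝ)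
    (hval : OPT ≤ ∑ i, p i * (x i + xhat i))
    (JI JIhat : Finset (Fin n))
    (hJI : JI = Finset.univ.filter (fun i => x i = 1))
    (hJIhat : JIhat = Finset.univ.filter (fun i => xhat i = 1)) :
    -- no fractional coordinate
    ((∀ t, (x t = 0 ∨ x t = 1) ∧ (xhat t = 0 ∨ xhat t = 1)) →
      Feas JI ∅ ∧ Feas ∅ JIhat ∧
      OPT / 2 ≤ max (∑ i ∈ JI, p i) (∑ i ∈ JIhat, p i)) ∧
    -- exactly one fractional coordinate, belonging to item i
    (∀ i : Fin n,
      (((0 < x i ∧ x i < 1) ∧ (xhat i = 0 ∨ xhat i = 1) ∧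
          (∀ t, t ≠ i → (x t = 0 ∨ x t = 1) ∧ (xhat t = 0 ∨ xhat t = 1))) ∨
       ((0 < xhat i ∧ xhat i < 1) ∧ (x i = 0 ∨ x i = 1) ∧
          (∀ t, t ≠ i → (x t = 0 ∨ x t = 1) ∧ (xhat t = 0 ∨ xhat t = 1)))) →
      Feas ∅ {i} ∧ Feas JI ∅ ∧ Feas ∅ JIhat ∧
      OPT / 3 ≤ max (p i) (max (∑ t ∈ JI, p t) (∑ t ∈ JIhat, p t))) ∧
    -- exactly two fractional coordinates, belonging to items i and j, with ŵ i ≥ ŵ j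
    (∀ i j : Fin n, i ≠ j → what j ≤ what i →
      ¬ ((x i = 0 ∨ x i = 1) ∧ (xhat i = 0 ∨ xhat i = 1)) →
      ¬ ((x j = 0 ∨ x j = 1) ∧ (xhat j = 0 ∨ xhat j = 1)) →
      (∀ t, t ≠ i → t ≠ j → (x t = 0 ∨ x t = 1) ∧ (xhat t = 0 ∨ xhat t = 1)) →
      ({t : Fin n | 0 < x t ∧ x t < 1}.ncard
        + {t : Fin n | 0 < xhat t ∧ xhat t < 1}.ncard = 2) →
      Feas ∅ {i} ∧ Feas JI ∅ ∧ Feas ∅ (JIhat ∪ {j}) ∧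
      OPT / 3 ≤ max (p i) (max (∑ t ∈ JI, p t) (∑ t ∈ JIhat ∪ {j}, p t))) := by
  change Q = relaxationPolytope w what B k at hQ
  subst hQ
  obtain ⟨hx, hxhat, hbudget, hk'⟩ := hext.1
  dsimp only at hx hxhat hbudget hk'
  have hw' : ∀ t, 0 ≤ w t := fun t => (hw t).1.trans (hw t).2
  have hwx : ∑ t ∈ JI, w t ≤ ∑ t, w t * x t :=
    hJI ▸ sum_filter_eq_one_le_sum_mul hw' fun t => (hx t).1
  have hwxhat : ∑ t ∈ JIhat, what t ≤ ∑ t, what t * xhat t :=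
    hJIhat ▸ sum_filter_eq_one_le_sum_mul (fun t => (hw t).1) fun t => (hxhat t).1
  have hx₀ : 0 ≤ ∑ t, w t * x t :=
    Finset.sum_nonneg fun t _ => mul_nonneg (hw' t) (hx t).1
  have hxhat₀ : 0 ≤ ∑ t, what t * xhat t :=
    Finset.sum_nonneg fun t _ => mul_nonneg (hw t).1 (hxhat t).1
  have hcardJ : JIhat.card ≤ k := by
    have h := sum_filter_eq_one_le_sum_mul (f := fun _ => 1) (fun _ => zero_le_one)
      fun t => (hxhat t).1
    rw [← hJIhat] at h
    simp only [Finset.sum_const, nsmul_eq_mul, mul_one, one_mul] at h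
    exact_mod_cast h.trans hk'
  have feasJI : Feas JI ∅ := (hFeas _ _).2 ⟨by simp, by simp; linarith, by simp⟩
  have feasJIhat : Feas ∅ JIhat := (hFeas _ _).2 ⟨by simp, by simp; linarith, hcardJ⟩
  have feas_singleton : ∀ i, Feas ∅ {i} := fun i =>
    (hFeas _ _).2 ⟨by simp, by simpa using hwB i, by simpa using hk⟩
  have hvalue : OPT ≤ ∑ t, p t * x t + ∑ t, p t * xhat t := by
    simpa [mul_add, Finset.sum_add_distrib] using hval
  have three : ∀ {a b c : ℝ}, OPT ≤ a + b + c → OPT / 3 ≤ max a (max b c) := by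
    intro a b c h
    have h₁ := le_max_left a (max b c)
    have h₂ := (le_max_left b c).trans (le_max_right a _)
    have h₃ := (le_max_right b c).trans (le_max_right a _)
    linarith
  have integral : ∀ {y : Fin n → ℝ}, (∀ t, y t = 0 ∨ y t = 1) →
      ∑ t, p t * y t = ∑ t with y t = 1, p t := fun {y} h => by
    simpa using sum_mul_eq_sum_filter_add_sum p ∅ (fun t _ => h t) (by simp)
  have fractional : ∀ {y : Fin n → ℝ} {i : Fin n}, y i < 1 →
      (∀ t, t ≠ i → y t = 0 ∨ y t = 1) →
      ∑ t, p t * y t ≤ ∑ t with y t = 1, p t + p i := fun {y i} hi h => by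
    have h₁ := sum_mul_eq_sum_filter_add_sum p {i} (by simpa using h) (by simpa using hi.ne)
    rw [Finset.sum_singleton] at h₁
    have := mul_le_of_le_one_right (hp i) hi.le
    linarith
  refine ⟨fun hint => ⟨feasJI, feasJIhat, ?_⟩,
    fun i hi => ⟨feas_singleton i, feasJI, feasJIhat, three ?_⟩,
    fun i j hij hwij hi hj hrest hcard => ?_⟩
  · have h₁ := integral fun t => (hint t).1
    have h₂ := integral fun t => (hint t).2
    rw [← hJI] at h₁
    rw [← hJIhat] at h₂
    have h₃ := le_max_left (∑ i ∈ JI, p i) (∑ i ∈ JIhat, p i)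
    have h₄ := le_max_right (∑ i ∈ JI, p i) (∑ i ∈ JIhat, p i)
    linarith
  · have glue : ∀ {y : Fin n → ℝ}, (y i = 0 ∨ y i = 1) →
        (∀ t, t ≠ i → y t = 0 ∨ y t = 1) → ∀ t, y t = 0 ∨ y t = 1 := fun h₀ h t => by
      by_cases hti : t = i
      · exact hti ▸ h₀
      · exact h t hti
    rcases hi with ⟨hfrac, hint, hrest⟩ | ⟨hfrac, hint, hrest⟩
    · have h₁ := fractional hfrac.2 fun t ht => (hrest t ht).1
      have h₂ := integral (glue hint fun t ht => (hrest t ht).2)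
      rw [← hJI] at h₁
      rw [← hJIhat] at h₂
      linarith
    · have h₁ := integral (glue hint fun t ht => (hrest t ht).1)
      have h₂ := fractional hfrac.2 fun t ht => (hrest t ht).2
      rw [← hJI] at h₁
      rw [← hJIhat] at h₂
      linarith
  · obtain ⟨hxint, hi', hj', hsum⟩ := two_fractional_structure hext hij hi hj hrest hcard
    have split : ∀ f : Fin n → ℝ, ∑ t, f t * xhat t
        = ∑ t ∈ JIhat, f t + (f i * xhat i + f j * xhat j) := fun f => by
      rw [sum_mul_eq_sum_filter_add_sum f {i, j}
        (fun t ht => by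
          simp only [Finset.mem_insert, Finset.mem_singleton, not_or] at ht
          exact (hrest t ht.1 ht.2).2)
        (fun t ht => by
          simp only [Finset.mem_insert, Finset.mem_singleton] at ht
          rcases ht with rfl | rfl
          exacts [hi'.2.ne, hj'.2.ne]), Finset.sum_pair hij, hJIhat]
    have hjJ : j ∉ JIhat := by simp [hJIhat, hj'.2.ne]
    have hdisj : Disjoint JIhat {j} := by simpa using hjJ
    have hone : (k : ℝ) = JIhat.card + (xhat i + xhat j) := by
      simpa [hsum] using split fun _ => 1
    have hcard₁ : JIhat.card + 1 = k := by
      have h₁ : JIhat.card < k := by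
        exact_mod_cast (by linarith : (JIhat.card : ℝ) < k)
      have h₂ : k < JIhat.card + 2 := by
        exact_mod_cast (by linarith : (k : ℝ) < (JIhat.card : ℝ) + 2)
      omega
    have hadd : xhat i + xhat j = 1 := by
      have : (JIhat.card : ℝ) + 1 = k := by exact_mod_cast hcard₁
      linarith
    refine ⟨feas_singleton i, feasJI, (hFeas _ _).2 ⟨by simp, ?_, ?_⟩, three ?_⟩
    · rw [Finset.sum_union hdisj, Finset.sum_singleton, Finset.sum_empty]
      have h₁ := split what
      have h₂ : what j ≤ what i * xhat i + what j * xhat j :=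
        calc what j = what j * xhat i + what j * xhat j := by rw [← mul_add, hadd, mul_one]
          _ ≤ _ := by gcongr; exact hi'.1.le
      linarith
    · rw [Finset.card_union_of_disjoint hdisj, Finset.card_singleton, hcard₁]
    · rw [Finset.sum_union hdisj, Finset.sum_singleton]
      have h₁ := integral hxint
      have h₂ := split p
      have h₃ := mul_le_of_le_one_right (hp i) hi'.2.le
      have h₄ := mul_le_of_le_one_right (hp j) hj'.2.le
      rw [← hJI] at h₁
      linarith
end
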